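/- arXiv:1812.11367 — 4 statements merged into one kernel-verified Lean document; each statement's English description precedes it below -/
import Mathlib

section
/- Let f : [0,1] → ℝⁿ be a regular smooth curve and let φ : [0,1] → ℝⁿ be smooth. Then the first variation of the elastic energy in direction φ is given by d/dε E(f + εφ) |_{ε=0} = [⟨∂ₛφ, κ⟩]₀¹ − [⟨φ, ∇ₛκ + ½|κ|² ∂ₛf⟩]₀¹ + ∫₀¹ ⟨∇ₛ²κ + ½|κ|²κ, φ⟩ ds, where [g]₀¹ = g(1) − g(0) and κ_{f+εφ} denotes the curvature vector of f + εφ. -/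
open Set MeasureTheory
open scoped RealInnerProductSpace

noncomputable section

/-- Arc-length derivative `∂ₛ g = |∂ₓ f|⁻¹ ∂ₓ g` along the curve `f`. -/
def sDeriv {n : ℕ} {F : Type*} [NormedAddCommGroup F] [NormedSpace ℝ F]
    (f : ℝ → EuclideanSpace ℝ (Fin n)) (g : ℝ → F) (x : ℝ) : F :=
  ‖deriv f x‖⁻¹ • deriv g x

/-- The unit tangent `τ = ∂ₛ f`. -/
def tau {n : ℕ} (f : ℝ → EuclideanSpace ℝ (Fin n)) : ℝ → EuclideanSpace ℝ (Fin n) :=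
  sDeriv f f

/-- The curvature vector `κ = ∂ₛ² f`. -/
def kappa {n : ℕ} (f : ℝ → EuclideanSpace ℝ (Fin n)) : ℝ → EuclideanSpace ℝ (Fin n) :=
  sDeriv f (tau f)

/-- Normal projection of the arc-length derivative: `∇ₛψ = ∂ₛψ − ⟨∂ₛψ, τ⟩ τ`. -/
def nablaS {n : ℕ} (f ψ : ℝ → EuclideanSpace ℝ (Fin n)) (x : ℝ) :
    EuclideanSpace ℝ (Fin n) :=
  sDeriv f ψ x - ⟪sDeriv f ψ x, tau f x⟫ • tau f x

section Helpers

variable {n : ℕ}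

/-- The energy density in terms of the first two derivatives. -/
def densG (a b : EuclideanSpace ℝ (Fin n)) : ℝ :=
  (‖b‖ ^ 2 * ‖a‖ ^ 2 - ⟪a, b⟫ ^ 2) * (‖a‖⁻¹) ^ 5

/-- Directional derivative of the energy density. -/
def densDG (a b p q : EuclideanSpace ℝ (Fin n)) : ℝ :=
  2 * (⟪b, q⟫ * ‖a‖ ^ 2 + ‖b‖ ^ 2 * ⟪a, p⟫ - ⟪a, b⟫ * (⟪p, b⟫ + ⟪a, q⟫)) * (‖a‖⁻¹) ^ 5
    - 5 * (‖b‖ ^ 2 * ‖a‖ ^ 2 - ⟪a, b⟫ ^ 2) * (‖a‖⁻¹) ^ 7 * ⟪a, p⟫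

lemma hasDerivAt_normInv {h : ℝ → EuclideanSpace ℝ (Fin n)} {h' : EuclideanSpace ℝ (Fin n)} {x : ℝ} (hh : HasDerivAt h h' x) (h0 : h x ≠ 0) :
    HasDerivAt (fun y => ‖h y‖⁻¹) (-(‖h x‖⁻¹) ^ 3 * ⟪h x, h'⟫) x := by
  have hn : ‖h x‖ ≠ 0 := norm_ne_zero_iff.mpr h0
  have h1 : HasDerivAt (fun y => ‖h y‖ ^ 2) (2 * ⟪h x, h'⟫) x := hh.norm_sq
  have h2 := (h1.sqrt (by positivity)).inv (by positivity)
  have e : (fun y => ‖h y‖⁻¹) = (fun y => √(‖h y‖ ^ 2))⁻¹ := by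
    funext y
    simp [Real.sqrt_sq (norm_nonneg _)]
  rw [e]
  refine h2.congr_deriv ?_
  rw [Real.sqrt_sq (norm_nonneg _)]
  field_simp

lemma hasDerivAt_densG {a b p q : EuclideanSpace ℝ (Fin n)} {ε : ℝ} (h0 : a + ε • p ≠ 0) :
    HasDerivAt (fun t : ℝ => densG (a + t • p) (b + t • q))
      (densDG (a + ε • p) (b + ε • q) p q) ε := by
  have ha : HasDerivAt (fun t : ℝ => a + t • p) p ε := by
    simpa using ((hasDerivAt_id ε).smul_const p).const_add a
  have hb : HasDerivAt (fun t : ℝ => b + t • q) q ε := by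
    simpa using ((hasDerivAt_id ε).smul_const q).const_add b
  have h1 := hasDerivAt_normInv ha h0
  have hA : HasDerivAt (fun t : ℝ => ‖a + t • p‖ ^ 2) _ ε := ha.norm_sq
  have hB : HasDerivAt (fun t : ℝ => ‖b + t • q‖ ^ 2) _ ε := hb.norm_sq
  have hab := ha.inner ℝ hb
  have := ((hB.mul hA).sub (hab.pow 2)).mul (h1.pow 5)
  refine this.congr_deriv ?_
  simp only [densDG, Pi.mul_apply, Pi.sub_apply, Pi.pow_apply]
  push_cast
  ring

lemma cd_deriv {F : Type*} [NormedAddCommGroup F] [NormedSpace ℝ F] {g : ℝ → F} {x : ℝ}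
    (hg : ContDiffAt ℝ (⊤ : ℕ∞) g x) : ContDiffAt ℝ (⊤ : ℕ∞) (deriv g) x := by
  have h : ContDiffAt ℝ (⊤ : ℕ∞) (fderiv ℝ g) x := hg.fderiv_right (by simp)
  exact h.clm_apply contDiffAt_const

lemma cd_sDeriv {f : ℝ → EuclideanSpace ℝ (Fin n)} {g : ℝ → EuclideanSpace ℝ (Fin n)} {x : ℝ} (hf : ContDiffAt ℝ (⊤ : ℕ∞) f x)
    (hg : ContDiffAt ℝ (⊤ : ℕ∞) g x) (h0 : deriv f x ≠ 0) :
    ContDiffAt ℝ (⊤ : ℕ∞) (sDeriv f g) x := by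
  unfold sDeriv
  exact (((cd_deriv hf).norm ℝ h0).inv (norm_ne_zero_iff.mpr h0)).smul (cd_deriv hg)

lemma hd_sDeriv {f g : ℝ → EuclideanSpace ℝ (Fin n)} {x : ℝ} (hg : ContDiffAt ℝ (⊤ : ℕ∞) g x) (h0 : deriv f x ≠ 0) :
    HasDerivAt g (‖deriv f x‖ • sDeriv f g x) x := by
  have := (hg.differentiableAt (by simp)).hasDerivAt
  rwa [sDeriv, smul_inv_smul₀ (norm_ne_zero_iff.mpr h0)]

lemma tau_inner {f : ℝ → EuclideanSpace ℝ (Fin n)} {x : ℝ} (h0 : deriv f x ≠ 0) : ⟪tau f x, tau f x⟫ = 1 := by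
  have : ‖deriv f x‖ ≠ 0 := norm_ne_zero_iff.mpr h0
  simp only [tau, sDeriv, inner_smul_left, inner_smul_right, real_inner_self_eq_norm_sq]
  simp
  field_simp

/-- The explicit formula for the arc-length derivative of an arc-length derivative. -/
lemma sDeriv_sDeriv {f g : ℝ → EuclideanSpace ℝ (Fin n)} {x : ℝ} (hf : ContDiffAt ℝ (⊤ : ℕ∞) f x)
    (hg : ContDiffAt ℝ (⊤ : ℕ∞) g x) (h0 : deriv f x ≠ 0) :
    sDeriv f (sDeriv f g) x = ((‖deriv f x‖⁻¹) ^ 2) • deriv (deriv g) x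
      - ((‖deriv f x‖⁻¹) ^ 4 * ⟪deriv f x, deriv (deriv f) x⟫) • deriv g x := by
  have h1 := hasDerivAt_normInv ((cd_deriv hf).differentiableAt (by simp)).hasDerivAt h0
  have h2 := ((cd_deriv hg).differentiableAt (by simp)).hasDerivAt
  have h3 : HasDerivAt (sDeriv f g) _ x := h1.smul h2
  rw [sDeriv, h3.deriv]
  module

lemma dens_eq {f : ℝ → EuclideanSpace ℝ (Fin n)} {x : ℝ} (hf : ContDiffAt ℝ (⊤ : ℕ∞) f x) (h0 : deriv f x ≠ 0) :
    ‖kappa f x‖ ^ 2 * ‖deriv f x‖ = densG (deriv f x) (deriv (deriv f) x) := by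
  have hn : ‖deriv f x‖ ≠ 0 := norm_ne_zero_iff.mpr h0
  rw [kappa, tau, sDeriv_sDeriv hf hf h0, densG, ← real_inner_self_eq_norm_sq]
  simp only [inner_sub_left, inner_sub_right, real_inner_smul_left, real_inner_smul_right,
    real_inner_comm (deriv f x) (deriv (deriv f) x)]
  simp only [real_inner_self_eq_norm_sq]
  field_simp
  ring

lemma dens_deriv_eq {f φ : ℝ → EuclideanSpace ℝ (Fin n)} {x : ℝ} (hf : ContDiffAt ℝ (⊤ : ℕ∞) f x)
    (hφ : ContDiffAt ℝ (⊤ : ℕ∞) φ x) (h0 : deriv f x ≠ 0) :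
    (1 / 2) * densDG (deriv f x) (deriv (deriv f) x) (deriv φ x) (deriv (deriv φ) x)
      = ‖deriv f x‖ * (⟪sDeriv f (sDeriv f φ) x, kappa f x⟫
        - (3 / 2) * ⟪kappa f x, kappa f x⟫ * ⟪sDeriv f φ x, tau f x⟫) := by
  have hn : ‖deriv f x‖ ≠ 0 := norm_ne_zero_iff.mpr h0
  rw [kappa, tau, sDeriv_sDeriv hf hf h0, sDeriv_sDeriv hf hφ h0, densDG, sDeriv, sDeriv]
  generalize deriv (deriv f) x = b
  generalize deriv (deriv φ) x = q
  generalize deriv φ x = p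
  revert hn
  generalize deriv f x = a
  intro hn
  simp only [inner_sub_left, inner_sub_right, real_inner_smul_left, real_inner_smul_right,
    real_inner_comm a b, real_inner_comm a p, real_inner_comm a q, real_inner_comm b p,
    real_inner_comm b q]
  simp only [real_inner_self_eq_norm_sq]
  field_simp
  ring

lemma cd_nablaS {f g : ℝ → EuclideanSpace ℝ (Fin n)} {x : ℝ} (hf : ContDiffAt ℝ (⊤ : ℕ∞) f x)
    (hg : ContDiffAt ℝ (⊤ : ℕ∞) g x) (h0 : deriv f x ≠ 0) :
    ContDiffAt ℝ (⊤ : ℕ∞) (nablaS f g) x := by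
  unfold nablaS
  have ht : ContDiffAt ℝ (⊤ : ℕ∞) (tau f) x := cd_sDeriv hf hf h0
  have h1 := cd_sDeriv hf hg h0
  exact h1.sub ((h1.inner ℝ ht).smul ht)

lemma nablaS_tau (f ψ : ℝ → EuclideanSpace ℝ (Fin n)) {x : ℝ} (h0 : deriv f x ≠ 0) :
    ⟪nablaS f ψ x, tau f x⟫ = 0 := by
  rw [nablaS, inner_sub_left, real_inner_smul_left, tau_inner h0]
  ring

/-- Differentiating an inner product which is locally constant. -/
lemma inner_const_deriv {f g h : ℝ → EuclideanSpace ℝ (Fin n)} {x c : ℝ}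
    (hg : ContDiffAt ℝ (⊤ : ℕ∞) g x) (hh : ContDiffAt ℝ (⊤ : ℕ∞) h x) (h0 : deriv f x ≠ 0)
    (hc : ∀ᶠ y in nhds x, ⟪g y, h y⟫ = c) :
    ⟪g x, sDeriv f h x⟫ + ⟪sDeriv f g x, h x⟫ = 0 := by
  have hn : ‖deriv f x‖ ≠ 0 := norm_ne_zero_iff.mpr h0
  have h1 := (hd_sDeriv (f := f) hg h0).inner ℝ (hd_sDeriv (f := f) hh h0)
  have h2 : HasDerivAt (fun y => ⟪g y, h y⟫) 0 x :=
    (hasDerivAt_const x c).congr_of_eventuallyEq hc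
  have h3 := h1.unique h2
  rw [real_inner_smul_left, real_inner_smul_right, ← mul_add] at h3
  exact (mul_eq_zero.mp h3).resolve_left hn

lemma boundary_deriv {f φ : ℝ → EuclideanSpace ℝ (Fin n)} (hf : ContDiff ℝ (⊤ : ℕ∞) f) (hφ : ContDiff ℝ (⊤ : ℕ∞) φ)
    {x : ℝ} (h0 : deriv f x ≠ 0) :
    HasDerivAt (fun x => ⟪sDeriv f φ x, kappa f x⟫
        - ⟪φ x, nablaS f (kappa f) x + ((1 / 2 : ℝ) * ‖kappa f x‖ ^ 2) • tau f x⟫)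
      ((1 / 2) * densDG (deriv f x) (deriv (deriv f) x) (deriv φ x) (deriv (deriv φ) x)
        - ⟪nablaS f (nablaS f (kappa f)) x + ((1 / 2 : ℝ) * ‖kappa f x‖ ^ 2) • kappa f x,
              φ x⟫ * ‖deriv f x‖) x := by
  have hU : ∀ᶠ y in nhds x, deriv f y ≠ 0 :=
    (hf.continuous_deriv (by simp)).continuousAt.eventually_ne h0
  have cf := hf.contDiffAt (x := x)
  have cp := hφ.contDiffAt (x := x)
  have ct : ∀ {y}, deriv f y ≠ 0 → ContDiffAt ℝ (⊤ : ℕ∞) (tau f) y :=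
    fun h => cd_sDeriv hf.contDiffAt hf.contDiffAt h
  have ck : ContDiffAt ℝ (⊤ : ℕ∞) (kappa f) x := cd_sDeriv cf (ct h0) h0
  have cN := cd_nablaS cf ck h0
  have cps := cd_sDeriv cf cp h0
  have o1 : ∀ {y}, deriv f y ≠ 0 → ⟪kappa f y, tau f y⟫ = 0 := by
    intro y hy
    have hUy : ∀ᶠ z in nhds y, deriv f z ≠ 0 :=
      (hf.continuous_deriv (by simp)).continuousAt.eventually_ne hy
    have := inner_const_deriv (f := f) (c := 1) (ct hy) (ct hy) hy
      (hUy.mono fun z hz => tau_inner hz)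
    change ⟪tau f y, kappa f y⟫ + ⟪kappa f y, tau f y⟫ = 0 at this
    rw [real_inner_comm] at this
    linarith
  have o2 := inner_const_deriv (f := f) (c := 0) ck (ct h0) h0 (hU.mono fun z hz => o1 hz)
  have o3 := inner_const_deriv (f := f) (c := 0) cN (ct h0) h0
    (hU.mono fun z hz => nablaS_tau f _ hz)
  change ⟪kappa f x, kappa f x⟫ + _ = 0 at o2
  change ⟪nablaS f (kappa f) x, kappa f x⟫ + _ = 0 at o3
  have dk := hd_sDeriv (f := f) ck h0
  have dk2 : HasDerivAt (fun y => ‖kappa f y‖ ^ 2) _ x := dk.norm_sq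
  have dt : HasDerivAt (tau f) (‖deriv f x‖ • kappa f x) x := hd_sDeriv (f := f) (ct h0) h0
  have D := ((hd_sDeriv (f := f) cps h0).inner ℝ dk).sub
    ((hd_sDeriv (f := f) cp h0).inner ℝ
      ((hd_sDeriv (f := f) cN h0).add ((dk2.const_mul (1 / 2 : ℝ)).smul dt)))
  refine D.congr_deriv ?_
  rw [dens_deriv_eq cf cp h0]
  have e1 : nablaS f (nablaS f (kappa f)) x = sDeriv f (nablaS f (kappa f)) x
      + ⟪nablaS f (kappa f) x, kappa f x⟫ • tau f x := by
    rw [nablaS, show ⟪sDeriv f (nablaS f (kappa f)) x, tau f x⟫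
      = -⟪nablaS f (kappa f) x, kappa f x⟫ by linarith]
    module
  have e2 : sDeriv f (kappa f) x = nablaS f (kappa f) x - ⟪kappa f x, kappa f x⟫ • tau f x := by
    rw [nablaS, show ⟪sDeriv f (kappa f) x, tau f x⟫ = -⟪kappa f x, kappa f x⟫ by linarith]
    module
  rw [e1, e2, ← real_inner_self_eq_norm_sq]
  have o4 := o1 h0
  have o5 : ⟪tau f x, kappa f x⟫ = 0 := by rw [real_inner_comm]; exact o4
  simp only [Pi.add_apply, Pi.smul_apply', inner_add_left, inner_add_right, inner_sub_left, inner_sub_right,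
    real_inner_smul_left, real_inner_smul_right, o4, o5,
    real_inner_comm (φ x)]
  simp only [real_inner_comm (nablaS f (kappa f) x) (kappa f x), real_inner_self_eq_norm_sq]
  ring

end Helpers

/-- First variation of the elastic energy `E(f) = ½ ∫₀¹ |κ|² ds`:
`d/dε E(f + εφ)|₍ε₌₀₎ = [⟨∂ₛφ, κ⟩]₀¹ − [⟨φ, ∇ₛκ + ½|κ|² ∂ₛf⟩]₀¹
  + ∫₀¹ ⟨∇ₛ²κ + ½|κ|²κ, φ⟩ ds`. -/
theorem firstVariation_elasticEnergy {n : ℕ} (hn : 2 ≤ n)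
    (f φ : ℝ → EuclideanSpace ℝ (Fin n))
    (hf : ContDiff ℝ (⊤ : ℕ∞) f) (hφ : ContDiff ℝ (⊤ : ℕ∞) φ)
    (hreg : ∀ x ∈ Icc (0 : ℝ) 1, deriv f x ≠ 0) :
    HasDerivAt
      (fun ε : ℝ =>
        (1 / 2 : ℝ) * ∫ x in (0 : ℝ)..1,
          ‖kappa (fun y => f y + ε • φ y) x‖ ^ 2 * ‖deriv (fun y => f y + ε • φ y) x‖)
      ((⟪sDeriv f φ 1, kappa f 1⟫ - ⟪sDeriv f φ 0, kappa f 0⟫)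
        - (⟪φ 1, nablaS f (kappa f) 1 + ((1 / 2 : ℝ) * ‖kappa f 1‖ ^ 2) • tau f 1⟫
            - ⟪φ 0, nablaS f (kappa f) 0 + ((1 / 2 : ℝ) * ‖kappa f 0‖ ^ 2) • tau f 0⟫)
        + ∫ x in (0 : ℝ)..1,
            ⟪nablaS f (nablaS f (kappa f)) x + ((1 / 2 : ℝ) * ‖kappa f x‖ ^ 2) • kappa f x,
              φ x⟫ * ‖deriv f x‖) 0 := by
  have cf1 : Continuous (deriv f) := hf.continuous_deriv (by simp)
  have cp1 : Continuous (deriv φ) := hφ.continuous_deriv (by simp)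
  have cf2 : Continuous (deriv (deriv f)) := continuous_iff_continuousAt.mpr fun x =>
    (cd_deriv (cd_deriv hf.contDiffAt)).continuousAt
  have cp2 : Continuous (deriv (deriv φ)) := continuous_iff_continuousAt.mpr fun x =>
    (cd_deriv (cd_deriv hφ.contDiffAt)).continuousAt
  have hd1 : ∀ ε x : ℝ, deriv (fun y => f y + ε • φ y) x = deriv f x + ε • deriv φ x := by
    intro ε x
    have h1 := ((hf.differentiable (by simp)) x).hasDerivAt
    have h2 := ((hφ.differentiable (by simp)) x).hasDerivAt
    exact (h1.add (h2.const_smul ε)).deriv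
  have hd2 : ∀ ε x : ℝ, deriv (deriv (fun y => f y + ε • φ y)) x
      = deriv (deriv f) x + ε • deriv (deriv φ) x := by
    intro ε x
    rw [show deriv (fun y => f y + ε • φ y) = fun x => deriv f x + ε • deriv φ x from
      funext (hd1 ε)]
    have h1 := ((cd_deriv (hf.contDiffAt (x := x))).differentiableAt (by simp)).hasDerivAt
    have h2 := ((cd_deriv (hφ.contDiffAt (x := x))).differentiableAt (by simp)).hasDerivAt
    exact (h1.add (h2.const_smul ε)).deriv
  -- uniform regularity for small parameters
  have hopen : IsOpen {z : ℝ × ℝ | deriv f z.2 + z.1 • deriv φ z.2 ≠ 0} :=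
    isOpen_ne_fun (by fun_prop) continuous_const
  obtain ⟨u, v, hu, hv, hsu, htv, huv⟩ := generalized_tube_lemma (isCompact_singleton (x := (0 : ℝ)))
    (isCompact_Icc (a := (0 : ℝ)) (b := 1)) hopen (by
      rintro ⟨e, x⟩ ⟨he, hx⟩
      have he0 : e = 0 := he
      subst he0
      simpa using hreg x hx)
  obtain ⟨δ, hδ, hball⟩ := Metric.nhds_basis_closedBall.mem_iff.mp
    (hu.mem_nhds (hsu (mem_singleton 0)))
  have hne : ∀ e ∈ Metric.closedBall (0 : ℝ) δ, ∀ x ∈ Icc (0 : ℝ) 1,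
      deriv f x + e • deriv φ x ≠ 0 := fun e he x hx => huv (mk_mem_prod (hball he) (htv hx))
  set G : ℝ → ℝ → ℝ := fun e x =>
    densG (deriv f x + e • deriv φ x) (deriv (deriv f) x + e • deriv (deriv φ) x) with hG
  set G' : ℝ → ℝ → ℝ := fun e x =>
    densDG (deriv f x + e • deriv φ x) (deriv (deriv f) x + e • deriv (deriv φ) x)
      (deriv φ x) (deriv (deriv φ) x) with hG'
  have hGc : ∀ e ∈ Metric.closedBall (0 : ℝ) δ, ContinuousOn (G e) (Icc 0 1) := by
    intro e he
    have hi : ContinuousOn (fun x => ‖deriv f x + e • deriv φ x‖⁻¹) (Icc 0 1) :=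
      ContinuousOn.inv₀ (by fun_prop) fun x hx => norm_ne_zero_iff.mpr (hne e he x hx)
    simp only [hG, densG]
    fun_prop
  have hG'c : ContinuousOn (fun z : ℝ × ℝ => G' z.1 z.2)
      (Metric.closedBall (0 : ℝ) δ ×ˢ Icc (0 : ℝ) 1) := by
    have hi : ContinuousOn (fun z : ℝ × ℝ => ‖deriv f z.2 + z.1 • deriv φ z.2‖⁻¹)
        (Metric.closedBall (0 : ℝ) δ ×ˢ Icc (0 : ℝ) 1) :=
      ContinuousOn.inv₀ (by fun_prop) fun z hz => norm_ne_zero_iff.mpr (hne _ hz.1 _ hz.2)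
    simp only [hG', densDG]
    fun_prop
  have h0b : (0 : ℝ) ∈ Metric.closedBall (0 : ℝ) δ := Metric.mem_closedBall_self hδ.le
  have hG'0 : ContinuousOn (G' 0) (Icc 0 1) :=
    hG'c.comp (f := fun x : ℝ => ((0 : ℝ), x)) (by fun_prop) fun x hx => mk_mem_prod h0b hx
  obtain ⟨C, hC⟩ := ((isCompact_closedBall (0 : ℝ) δ).prod isCompact_Icc).exists_bound_of_continuousOn
    hG'c
  have hsub : uIoc (0 : ℝ) 1 ⊆ Icc 0 1 := by
    rw [uIoc_of_le zero_le_one]; exact Ioc_subset_Icc_self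
  have hnb : Metric.closedBall (0 : ℝ) δ ∈ nhds (0 : ℝ) := Metric.closedBall_mem_nhds _ hδ
  have key : HasDerivAt (fun e => ∫ x in (0 : ℝ)..1, G e x) (∫ x in (0 : ℝ)..1, G' 0 x) 0 := by
    refine (intervalIntegral.hasDerivAt_integral_of_dominated_loc_of_deriv_le
      (bound := fun _ => C) hnb ?_ ?_ ?_ ?_ ?_ ?_).2
    · filter_upwards [hnb] with e he
      exact ((hGc e he).mono hsub).aestronglyMeasurable measurableSet_uIoc
    · exact ContinuousOn.intervalIntegrable_of_Icc zero_le_one (hGc 0 h0b)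
    · exact (hG'0.mono hsub).aestronglyMeasurable measurableSet_uIoc
    · exact Filter.Eventually.of_forall fun x hx e he => hC (e, x) (mk_mem_prod he (hsub hx))
    · exact intervalIntegrable_const
    · exact Filter.Eventually.of_forall fun x hx e he =>
        hasDerivAt_densG (hne e he x (hsub hx))
  have key2 := (key.const_mul (1 / 2 : ℝ)).congr_of_eventuallyEq (f₁ := fun ε : ℝ =>
        (1 / 2 : ℝ) * ∫ x in (0 : ℝ)..1,
          ‖kappa (fun y => f y + ε • φ y) x‖ ^ 2 * ‖deriv (fun y => f y + ε • φ y) x‖) (by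
    filter_upwards [hnb] with e he
    congr 1
    refine intervalIntegral.integral_congr fun x hx => ?_
    rw [uIcc_of_le zero_le_one] at hx
    have hs : ContDiffAt ℝ (⊤ : ℕ∞) (fun y => f y + e • φ y) x :=
      (hf.add (hφ.const_smul e)).contDiffAt
    have := dens_eq hs (by rw [hd1]; exact hne e he x hx)
    simp only [hG]
    rw [this, hd1, hd2])
  refine key2.congr_deriv ?_
  set I : ℝ → ℝ := fun x =>
    ⟪nablaS f (nablaS f (kappa f)) x + ((1 / 2 : ℝ) * ‖kappa f x‖ ^ 2) • kappa f x,
              φ x⟫ * ‖deriv f x‖ with hI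
  have hIc : ContinuousOn I (Icc 0 1) := by
    intro x hx
    have h0 := hreg x hx
    have ct : ContDiffAt ℝ (⊤ : ℕ∞) (tau f) x := cd_sDeriv hf.contDiffAt hf.contDiffAt h0
    have ck : ContDiffAt ℝ (⊤ : ℕ∞) (kappa f) x := cd_sDeriv hf.contDiffAt ct h0
    have cN := (cd_nablaS hf.contDiffAt (cd_nablaS hf.contDiffAt ck h0) h0).continuousAt
    have ck' := ck.continuousAt
    have cφ := hφ.continuous.continuousAt (x := x)
    have c1 := cf1.continuousAt (x := x)
    apply ContinuousAt.continuousWithinAt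
    simp only [hI]
    fun_prop
  have iI : IntervalIntegrable I volume 0 1 := hIc.intervalIntegrable_of_Icc zero_le_one
  have iG : IntervalIntegrable (fun x => (1 / 2 : ℝ) * G' 0 x) volume 0 1 :=
    (hG'0.intervalIntegrable_of_Icc zero_le_one).const_mul _
  have ftc := intervalIntegral.integral_eq_sub_of_hasDerivAt (a := 0) (b := 1)
    (f := fun x => ⟪sDeriv f φ x, kappa f x⟫
        - ⟪φ x, nablaS f (kappa f) x + ((1 / 2 : ℝ) * ‖kappa f x‖ ^ 2) • tau f x⟫)
    (f' := fun x => (1 / 2 : ℝ) * G' 0 x - I x) (by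
      intro x hx
      rw [uIcc_of_le zero_le_one] at hx
      have := boundary_deriv hf hφ (hreg x hx)
      simpa only [hG', hI, zero_smul, add_zero] using this) (iG.sub iI)
  rw [intervalIntegral.integral_sub iG iI, intervalIntegral.integral_const_mul] at ftc
  linarith
end
end

section
/- Let Γ(t) = {f₁(t,·), f₂(t,·), f₃(t,·)} be a smooth solution of the elastic network flow ∂ₜfᵢ = −∇ₛ²κᵢ − ½|κᵢ|²κᵢ + λᵢκᵢ + φᵢ ∂ₛfᵢ on (0,T) × [0,1], with λᵢ > 0 constants and subject to the boundary conditions fᵢ(t,1) = Pᵢ, κᵢ(t,0) = κᵢ(t,1) = 0, f₁(t,0) = f₂(t,0) = f₃(t,0), and Σᵢ₌₁³ (∇ₛκᵢ(t,0) − λᵢ ∂ₛfᵢ(t,0)) = 0 for all t ∈ (0,T). Then d/dt Σᵢ₌₁³ E_{λᵢ}(fᵢ(t,·)) = − Σᵢ₌₁³ ∫₀¹ |∂ₜfᵢ − φᵢ ∂ₛfᵢ|² ds ≤ 0; in particular the total energy Σᵢ E_{λᵢ}(fᵢ(t,·)) is non-increasing in t. -/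
open Set MeasureTheory
open scoped RealInnerProductSpace

noncomputable section

/-- Partial time derivative of a time-dependent field. -/
def pT {F : Type*} [NormedAddCommGroup F] [NormedSpace ℝ F]
    (g : ℝ → ℝ → F) (t x : ℝ) : F :=
  deriv (fun s => g s x) t

/-- Length of the curve `f` over `[0,1]`. -/
def curveLen {n : ℕ} (f : ℝ → EuclideanSpace ℝ (Fin n)) : ℝ :=
  ∫ x in (0 : ℝ)..1, ‖deriv f x‖

/-- Elastic energy `E(f) = ½ ∫₀¹ |κ|² ds`. -/
def elasticE {n : ℕ} (f : ℝ → EuclideanSpace ℝ (Fin n)) : ℝ :=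
  (1 / 2 : ℝ) * ∫ x in (0 : ℝ)..1, ‖kappa f x‖ ^ 2 * ‖deriv f x‖

/-- Penalised elastic energy `E_λ(f) = E(f) + λ L(f)`. -/
def elasticELam {n : ℕ} (lam : ℝ) (f : ℝ → EuclideanSpace ℝ (Fin n)) : ℝ :=
  elasticE f + lam * curveLen f

set_option linter.unusedSectionVars false

def SmoothU {F : Type*} [NormedAddCommGroup F] [NormedSpace ℝ F]
    (U : Set (ℝ × ℝ)) (G : ℝ → ℝ → F) : Prop :=
  ContDiffOn ℝ (⊤ : ℕ∞) (Function.uncurry G) U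

section basic
variable {F : Type*} [NormedAddCommGroup F] [NormedSpace ℝ F] {U : Set (ℝ × ℝ)}
  {G : ℝ → ℝ → F}

lemma SmoothU.fderivAt (hU : IsOpen U) (hG : SmoothU U G) {t x : ℝ} (h : (t, x) ∈ U) :
    HasFDerivAt (Function.uncurry G) (fderiv ℝ (Function.uncurry G) (t, x)) (t, x) :=
  ((hG.contDiffAt (hU.mem_nhds h)).differentiableAt (by simp)).hasFDerivAt

lemma SmoothU.hx' (hU : IsOpen U) (hG : SmoothU U G) {t x : ℝ} (h : (t, x) ∈ U) :
    HasDerivAt (G t) (fderiv ℝ (Function.uncurry G) (t, x) (0, 1)) x := by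
  have h1 : HasDerivAt (fun y : ℝ => (t, y)) ((0 : ℝ), (1 : ℝ)) x :=
    (hasDerivAt_const x t).prodMk (hasDerivAt_id x)
  exact (hG.fderivAt hU h).comp_hasDerivAt x h1

lemma SmoothU.ht' (hU : IsOpen U) (hG : SmoothU U G) {t x : ℝ} (h : (t, x) ∈ U) :
    HasDerivAt (fun s => G s x) (fderiv ℝ (Function.uncurry G) (t, x) (1, 0)) t := by
  have h1 : HasDerivAt (fun y : ℝ => (y, x)) ((1 : ℝ), (0 : ℝ)) t :=
    (hasDerivAt_id t).prodMk (hasDerivAt_const t x)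
  exact (hG.fderivAt hU h).comp_hasDerivAt t h1

lemma SmoothU.hx (hU : IsOpen U) (hG : SmoothU U G) {t x : ℝ} (h : (t, x) ∈ U) :
    HasDerivAt (G t) (deriv (G t) x) x :=
  (hG.hx' hU h).differentiableAt.hasDerivAt

lemma SmoothU.ht (hU : IsOpen U) (hG : SmoothU U G) {t x : ℝ} (h : (t, x) ∈ U) :
    HasDerivAt (fun s => G s x) (pT G t x) t :=
  (hG.ht' hU h).differentiableAt.hasDerivAt

lemma SmoothU.fd (hU : IsOpen U) (hG : SmoothU U G) (w : ℝ × ℝ) :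
    ContDiffOn ℝ (⊤ : ℕ∞) (fun p => fderiv ℝ (Function.uncurry G) p w) U :=
  (ContDiffOn.fderiv_of_isOpen hG hU (by simp)).clm_apply contDiffOn_const

lemma SmoothU.dx (hU : IsOpen U) (hG : SmoothU U G) :
    SmoothU U (fun t x => deriv (G t) x) :=
  (hG.fd hU (0, 1)).congr fun _ hp => (hG.hx' hU hp).deriv

lemma SmoothU.dt (hU : IsOpen U) (hG : SmoothU U G) : SmoothU U (pT G) :=
  (hG.fd hU (1, 0)).congr fun _ hp => (hG.ht' hU hp).deriv

lemma SmoothU.congr' {H : ℝ → ℝ → F} (hG : SmoothU U G)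
    (h : ∀ t x, (t, x) ∈ U → H t x = G t x) : SmoothU U H :=
  ContDiffOn.congr hG fun p hp => h p.1 p.2 hp

/-- equality on an open set passes to derivatives -/
lemma eventually_x (hU : IsOpen U) {H : ℝ → ℝ → F}
    (h : ∀ t x, (t, x) ∈ U → H t x = G t x) {t x : ℝ} (hp : (t, x) ∈ U) :
    H t =ᶠ[nhds x] G t := by
  have : ContinuousAt (fun y : ℝ => (t, y)) x := by fun_prop
  filter_upwards [this.preimage_mem_nhds (hU.mem_nhds hp)] with y hy using h t y hy

lemma eventually_t (hU : IsOpen U) {H : ℝ → ℝ → F}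
    (h : ∀ t x, (t, x) ∈ U → H t x = G t x) {t x : ℝ} (hp : (t, x) ∈ U) :
    (fun s => H s x) =ᶠ[nhds t] (fun s => G s x) := by
  have : ContinuousAt (fun y : ℝ => (y, x)) t := by fun_prop
  filter_upwards [this.preimage_mem_nhds (hU.mem_nhds hp)] with y hy using h y x hy

lemma clm_dt {D : ℝ × ℝ → (ℝ × ℝ →L[ℝ] F)} {D' : ℝ × ℝ →L[ℝ] (ℝ × ℝ →L[ℝ] F)} {t x : ℝ}
    (hD : HasFDerivAt D D' (t, x)) (w : ℝ × ℝ) :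
    HasDerivAt (fun s => D (s, x) w) (D' (1, 0) w) t := by
  have h1 : HasDerivAt (fun y : ℝ => (y, x)) ((1 : ℝ), (0 : ℝ)) t :=
    (hasDerivAt_id t).prodMk (hasDerivAt_const t x)
  have h2 : HasDerivAt (fun s => D (s, x)) (D' (1, 0)) t := hD.comp_hasDerivAt t h1
  simpa using h2.clm_apply (hasDerivAt_const t w)

lemma clm_dx {D : ℝ × ℝ → (ℝ × ℝ →L[ℝ] F)} {D' : ℝ × ℝ →L[ℝ] (ℝ × ℝ →L[ℝ] F)} {t x : ℝ}
    (hD : HasFDerivAt D D' (t, x)) (w : ℝ × ℝ) :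
    HasDerivAt (fun y => D (t, y) w) (D' (0, 1) w) x := by
  have h1 : HasDerivAt (fun y : ℝ => (t, y)) ((0 : ℝ), (1 : ℝ)) x :=
    (hasDerivAt_const x t).prodMk (hasDerivAt_id x)
  have h2 : HasDerivAt (fun y => D (t, y)) (D' (0, 1)) x := hD.comp_hasDerivAt x h1
  simpa using h2.clm_apply (hasDerivAt_const x w)

lemma SmoothU.comm (hU : IsOpen U) (hG : SmoothU U G) {t x : ℝ} (h : (t, x) ∈ U) :
    pT (fun t x => deriv (G t) x) t x = deriv (pT G t) x := by
  have hs : IsSymmSndFDerivAt ℝ (Function.uncurry G) (t, x) :=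
    (hG.contDiffAt (hU.mem_nhds h)).isSymmSndFDerivAt (by
      rw [minSmoothness_of_isRCLikeNormedField]
      exact WithTop.coe_le_coe.2 (le_top : (2 : ℕ∞) ≤ ⊤))
  have hD : HasFDerivAt (fderiv ℝ (Function.uncurry G))
      (fderiv ℝ (fderiv ℝ (Function.uncurry G)) (t, x)) (t, x) :=
    (((ContDiffOn.fderiv_of_isOpen hG hU (m := (⊤ : ℕ∞)) (by simp)).contDiffAt
      (hU.mem_nhds h)).differentiableAt (by simp)).hasFDerivAt
  have e1 : (fun s => deriv (G s) x) =ᶠ[nhds t]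
      fun s => fderiv ℝ (Function.uncurry G) (s, x) (0, 1) :=
    eventually_t (H := fun t x => deriv (G t) x)
      (G := fun t x => fderiv ℝ (Function.uncurry G) (t, x) (0, 1)) hU
      (fun t x hp => (hG.hx' hU hp).deriv) h
  have e2 : pT G t =ᶠ[nhds x] fun y => fderiv ℝ (Function.uncurry G) (t, y) (1, 0) :=
    eventually_x (H := pT G)
      (G := fun t x => fderiv ℝ (Function.uncurry G) (t, x) (1, 0)) hU
      (fun t x hp => (hG.ht' hU hp).deriv) h
  have d1 := clm_dt hD (0, 1)
  have d2 := clm_dx hD (1, 0)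
  have r1 : pT (fun t x => deriv (G t) x) t x = _ := (d1.congr_of_eventuallyEq e1).deriv
  have r2 := (d2.congr_of_eventuallyEq e2).deriv
  rw [r1, r2]
  exact hs (1, 0) (0, 1)

/-- differentiation under the integral sign -/
lemma hasDerivAt_int {e : ℝ → ℝ → ℝ} (hU : IsOpen U) (he : SmoothU U e) {t a b : ℝ}
    (hab : t ∈ Ioo a b)
    (hsub : ∀ s ∈ Ioo a b, ∀ x ∈ Icc (0 : ℝ) 1, (s, x) ∈ U) :
    HasDerivAt (fun s => ∫ x in (0 : ℝ)..1, e s x) (∫ x in (0 : ℝ)..1, pT e t x) t := by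
  obtain ⟨δ, hδ, hball⟩ := Metric.isOpen_iff.1 (isOpen_Ioo (a := a) (b := b)) t hab
  have hK : ∀ s ∈ Metric.closedBall t (δ / 2), s ∈ Ioo a b := fun s hs =>
    hball (Metric.closedBall_subset_ball (by linarith) hs)
  have hcomp : IsCompact (Metric.closedBall t (δ / 2) ×ˢ Icc (0 : ℝ) 1) :=
    (isCompact_closedBall _ _).prod isCompact_Icc
  have hcont : ContinuousOn (Function.uncurry (pT e))
      (Metric.closedBall t (δ / 2) ×ˢ Icc (0 : ℝ) 1) :=
    (he.dt hU).continuousOn.mono fun p hp => hsub p.1 (hK _ hp.1) p.2 hp.2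
  obtain ⟨C, hC⟩ := hcomp.exists_bound_of_continuousOn hcont
  have sec : ∀ (g : ℝ → ℝ → ℝ), SmoothU U g → ∀ s ∈ Ioo a b, 
      ContinuousOn (g s) (Icc 0 1) := fun g hg s hs x hx =>
    (hg.hx hU (hsub s hs x hx)).continuousAt.continuousWithinAt
  have hint : ∀ (g : ℝ → ℝ → ℝ), SmoothU U g → ∀ s ∈ Ioo a b, 
      IntervalIntegrable (g s) volume 0 1 := fun g hg s hs =>
    ContinuousOn.intervalIntegrable (by rw [uIcc_of_le zero_le_one]; exact sec g hg s hs)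
  have hIoc : ∀ x ∈ uIoc (0 : ℝ) 1, x ∈ Icc (0 : ℝ) 1 := fun x hx => by
    rw [uIoc_of_le zero_le_one] at hx; exact Ioc_subset_Icc_self hx
  refine (intervalIntegral.hasDerivAt_integral_of_dominated_loc_of_deriv_le
    (bound := fun _ => C) (s := Metric.closedBall t (δ / 2)) (F' := pT e)
    (Metric.closedBall_mem_nhds _ (by linarith)) ?_ (hint e he t hab) ?_ ?_ ?_ ?_).2
  · filter_upwards [Metric.closedBall_mem_nhds t (half_pos hδ)] with s hs
    exact (intervalIntegrable_iff.1 (hint e he s (hK s hs))).aestronglyMeasurable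
  · exact (intervalIntegrable_iff.1 (hint _ (he.dt hU) t hab)).aestronglyMeasurable
  · exact Filter.Eventually.of_forall fun x hx s hs => hC (s, x) ⟨hs, hIoc x hx⟩
  · exact intervalIntegrable_const
  · exact Filter.Eventually.of_forall fun x hx s hs => 
      he.ht hU (hsub s (hK s hs) x (hIoc x hx))
end basic

section curve
variable {n : ℕ} {f : ℝ → ℝ → EuclideanSpace ℝ (Fin n)}

def regSet (f : ℝ → ℝ → EuclideanSpace ℝ (Fin n)) : Set (ℝ × ℝ) :=
  {p | deriv (f p.1) p.2 ≠ 0}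

def speed (f : ℝ → ℝ → EuclideanSpace ℝ (Fin n)) (t x : ℝ) : ℝ := ‖deriv (f t) x‖
def tauF (f : ℝ → ℝ → EuclideanSpace ℝ (Fin n)) (t x : ℝ) := tau (f t) x
def kapF (f : ℝ → ℝ → EuclideanSpace ℝ (Fin n)) (t x : ℝ) := kappa (f t) x
def nabF (f : ℝ → ℝ → EuclideanSpace ℝ (Fin n)) (t x : ℝ) := nablaS (f t) (kappa (f t)) x
def nab2F (f : ℝ → ℝ → EuclideanSpace ℝ (Fin n)) (t x : ℝ) :=
  nablaS (f t) (nablaS (f t) (kappa (f t))) x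
def wF (f : ℝ → ℝ → EuclideanSpace ℝ (Fin n)) (t x : ℝ) := sDeriv (f t) (pT f t) x
def etaF (f : ℝ → ℝ → EuclideanSpace ℝ (Fin n)) (t x : ℝ) : ℝ := ⟪wF f t x, tauF f t x⟫
def densF (l : ℝ) (f : ℝ → ℝ → EuclideanSpace ℝ (Fin n)) (t x : ℝ) : ℝ :=
  (1 / 2 : ℝ) * (⟪kapF f t x, kapF f t x⟫ * speed f t x) + l * speed f t x
def fluxF (l : ℝ) (f : ℝ → ℝ → EuclideanSpace ℝ (Fin n)) (t x : ℝ) : ℝ :=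
  ⟪kapF f t x, wF f t x⟫ - ⟪nabF f t x, pT f t x⟫
    - ((1 / 2 : ℝ) * ⟪kapF f t x, kapF f t x⟫ - l) * ⟪tauF f t x, pT f t x⟫

lemma smooth_univ (hf : ContDiff ℝ (⊤ : ℕ∞) (Function.uncurry f)) : SmoothU Set.univ f :=
  hf.contDiffOn

lemma regSet_open (hf : ContDiff ℝ (⊤ : ℕ∞) (Function.uncurry f)) : IsOpen (regSet f) := by
  have h := ((smooth_univ hf).dx isOpen_univ).continuousOn
  rw [continuousOn_univ] at h
  exact isOpen_ne_fun h continuous_const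

lemma smooth_f (hf : ContDiff ℝ (⊤ : ℕ∞) (Function.uncurry f)) : SmoothU (regSet f) f :=
  hf.contDiffOn

lemma smooth_speed (hf : ContDiff ℝ (⊤ : ℕ∞) (Function.uncurry f)) :
    SmoothU (regSet f) (speed f) :=
  ContDiffOn.norm ℝ ((smooth_f hf).dx (regSet_open hf)) fun _ hp => hp

lemma speed_ne {t x : ℝ} (h : (t, x) ∈ regSet f) : speed f t x ≠ 0 := norm_ne_zero_iff.2 h

lemma smooth_sDeriv {F : Type*} [NormedAddCommGroup F] [NormedSpace ℝ F] {g : ℝ → ℝ → F}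
    (hf : ContDiff ℝ (⊤ : ℕ∞) (Function.uncurry f)) (hg : SmoothU (regSet f) g) :
    SmoothU (regSet f) (fun t x => sDeriv (f t) (g t) x) :=
  ContDiffOn.smul ((smooth_speed hf).inv fun p hp => speed_ne (t := p.1) (x := p.2) hp)
    (hg.dx (regSet_open hf))

lemma smooth_tau (hf : ContDiff ℝ (⊤ : ℕ∞) (Function.uncurry f)) :
    SmoothU (regSet f) (tauF f) := smooth_sDeriv hf (smooth_f hf)

lemma smooth_kap (hf : ContDiff ℝ (⊤ : ℕ∞) (Function.uncurry f)) :
    SmoothU (regSet f) (kapF f) := smooth_sDeriv hf (smooth_tau hf)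

lemma smooth_inner {g h : ℝ → ℝ → EuclideanSpace ℝ (Fin n)} {U : Set (ℝ × ℝ)}
    (hg : SmoothU U g) (hh : SmoothU U h) :
    SmoothU U (fun t x => ⟪g t x, h t x⟫) := ContDiffOn.inner ℝ hg hh

lemma smooth_nabla {g : ℝ → ℝ → EuclideanSpace ℝ (Fin n)}
    (hf : ContDiff ℝ (⊤ : ℕ∞) (Function.uncurry f)) (hg : SmoothU (regSet f) g) :
    SmoothU (regSet f) (fun t x => nablaS (f t) (g t) x) :=
  ContDiffOn.sub (smooth_sDeriv hf hg)
    (ContDiffOn.smul (smooth_inner (smooth_sDeriv hf hg) (smooth_tau hf)) (smooth_tau hf))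

lemma smooth_nab (hf : ContDiff ℝ (⊤ : ℕ∞) (Function.uncurry f)) :
    SmoothU (regSet f) (nabF f) := smooth_nabla hf (smooth_kap hf)

lemma smooth_nab2 (hf : ContDiff ℝ (⊤ : ℕ∞) (Function.uncurry f)) :
    SmoothU (regSet f) (nab2F f) := smooth_nabla hf (smooth_nab hf)

lemma smooth_W (hf : ContDiff ℝ (⊤ : ℕ∞) (Function.uncurry f)) :
    SmoothU (regSet f) (pT f) := (smooth_f hf).dt (regSet_open hf)

lemma smooth_w (hf : ContDiff ℝ (⊤ : ℕ∞) (Function.uncurry f)) :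
    SmoothU (regSet f) (wF f) := smooth_sDeriv hf (smooth_W hf)

lemma smooth_eta (hf : ContDiff ℝ (⊤ : ℕ∞) (Function.uncurry f)) :
    SmoothU (regSet f) (etaF f) := smooth_inner (smooth_w hf) (smooth_tau hf)

lemma smooth_dens (l : ℝ) (hf : ContDiff ℝ (⊤ : ℕ∞) (Function.uncurry f)) :
    SmoothU (regSet f) (densF l f) :=
  ContDiffOn.add (ContDiffOn.mul contDiffOn_const
    (ContDiffOn.mul (smooth_inner (smooth_kap hf) (smooth_kap hf)) (smooth_speed hf)))
    (ContDiffOn.mul contDiffOn_const (smooth_speed hf))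

lemma smooth_flux (l : ℝ) (hf : ContDiff ℝ (⊤ : ℕ∞) (Function.uncurry f)) :
    SmoothU (regSet f) (fluxF l f) :=
  ContDiffOn.sub (ContDiffOn.sub (smooth_inner (smooth_kap hf) (smooth_w hf))
      (smooth_inner (smooth_nab hf) (smooth_W hf)))
    (ContDiffOn.mul (ContDiffOn.sub (ContDiffOn.mul contDiffOn_const
      (smooth_inner (smooth_kap hf) (smooth_kap hf))) contDiffOn_const)
      (smooth_inner (smooth_tau hf) (smooth_W hf)))

lemma deriv_eq_smul {F : Type*} [NormedAddCommGroup F] [NormedSpace ℝ F] (g : ℝ → F)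
    {t x : ℝ} (h : (t, x) ∈ regSet f) :
    deriv g x = speed f t x • sDeriv (f t) g x :=
  (smul_inv_smul₀ (speed_ne h) _).symm

lemma tau_unit {t x : ℝ} (h : (t, x) ∈ regSet f) : ⟪tauF f t x, tauF f t x⟫ = 1 := by
  have : ‖tauF f t x‖ = 1 := by
    change ‖(speed f t x)⁻¹ • deriv (f t) x‖ = 1
    rw [norm_smul, norm_inv, Real.norm_eq_abs, speed, abs_norm]
    exact inv_mul_cancel₀ (speed_ne h)
  rw [real_inner_self_eq_norm_sq, this, one_pow]

lemma dx_inner {g h : ℝ → ℝ → EuclideanSpace ℝ (Fin n)} {U : Set (ℝ × ℝ)} (hU : IsOpen U)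
    (hg : SmoothU U g) (hh : SmoothU U h) {c : ℝ} (hc : ∀ t x, (t, x) ∈ U → ⟪g t x, h t x⟫ = c)
    {t x : ℝ} (hp : (t, x) ∈ U) :
    ⟪g t x, deriv (h t) x⟫ + ⟪deriv (g t) x, h t x⟫ = 0 := by
  have h1 := (hg.hx hU hp).inner ℝ (hh.hx hU hp)
  have h2 := eventually_x (H := fun t x => ⟪g t x, h t x⟫) (G := fun _ _ => c) hU hc hp
  exact h1.unique ((hasDerivAt_const x c).congr_of_eventuallyEq h2)

lemma dt_inner {g h : ℝ → ℝ → EuclideanSpace ℝ (Fin n)} {U : Set (ℝ × ℝ)} (hU : IsOpen U)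
    (hg : SmoothU U g) (hh : SmoothU U h) {c : ℝ} (hc : ∀ t x, (t, x) ∈ U → ⟪g t x, h t x⟫ = c)
    {t x : ℝ} (hp : (t, x) ∈ U) :
    ⟪g t x, pT h t x⟫ + ⟪pT g t x, h t x⟫ = 0 := by
  have h1 := (hg.ht hU hp).inner ℝ (hh.ht hU hp)
  have h2 := eventually_t (H := fun t x => ⟪g t x, h t x⟫) (G := fun _ _ => c) hU hc hp
  exact h1.unique ((hasDerivAt_const t c).congr_of_eventuallyEq h2)

lemma dtau {t x : ℝ} (h : (t, x) ∈ regSet f) :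
    deriv (tauF f t) x = speed f t x • kapF f t x := deriv_eq_smul _ h

lemma dW {t x : ℝ} (h : (t, x) ∈ regSet f) :
    deriv (pT f t) x = speed f t x • wF f t x := deriv_eq_smul _ h

lemma kap_tau (hf : ContDiff ℝ (⊤ : ℕ∞) (Function.uncurry f)) (t x : ℝ)
    (h : (t, x) ∈ regSet f) : ⟪kapF f t x, tauF f t x⟫ = 0 := by
  have := dx_inner (regSet_open hf) (smooth_tau hf) (smooth_tau hf)
    (fun t x h => tau_unit h) h
  rw [dtau h, real_inner_smul_left, real_inner_smul_right, real_inner_comm] at this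
  have h2 : speed f t x * ⟪kapF f t x, tauF f t x⟫ = 0 := by linarith
  exact (mul_eq_zero.1 h2).resolve_left (speed_ne h)

lemma nabla_tau (g : ℝ → EuclideanSpace ℝ (Fin n)) {t x : ℝ} (h : (t, x) ∈ regSet f) :
    ⟪nablaS (f t) g x, tauF f t x⟫ = 0 := by
  have := tau_unit h
  unfold tauF at *
  rw [nablaS, inner_sub_left, real_inner_smul_left, this]; ring

/-- The derivative of a normal field. -/
lemma d_normal (hf : ContDiff ℝ (⊤ : ℕ∞) (Function.uncurry f))
    {g : ℝ → ℝ → EuclideanSpace ℝ (Fin n)} (hg : SmoothU (regSet f) g)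
    (hn : ∀ t x, (t, x) ∈ regSet f → ⟪g t x, tauF f t x⟫ = 0)
    {t x : ℝ} (h : (t, x) ∈ regSet f) :
    deriv (g t) x = speed f t x •
      (nablaS (f t) (g t) x - ⟪g t x, kapF f t x⟫ • tauF f t x) := by
  have h1 := dx_inner (regSet_open hf) hg (smooth_tau hf) hn h
  rw [dtau h, deriv_eq_smul (g t) h, real_inner_smul_left, real_inner_smul_right, ← mul_add] at h1
  have h2 := (mul_eq_zero.1 h1).resolve_left (speed_ne h)
  rw [deriv_eq_smul (g t) h]
  congr 1
  have h3 : ⟪g t x, kapF f t x⟫ = -⟪sDeriv (f t) (g t) x, tauF f t x⟫ := by linarith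
  rw [h3, nablaS]
  unfold tauF
  module

lemma time_tau (hf : ContDiff ℝ (⊤ : ℕ∞) (Function.uncurry f)) {t x : ℝ}
    (h : (t, x) ∈ regSet f) :
    pT (speed f) t x = speed f t x * etaF f t x ∧
    pT (tauF f) t x = wF f t x - etaF f t x • tauF f t x := by
  have hU := regSet_open hf
  have h1 : HasDerivAt (fun s => deriv (f s) x) (deriv (pT f t) x) t := by
    rw [← (smooth_f hf).comm hU h]
    exact ((smooth_f hf).dx hU).ht hU h
  have h2 := ((smooth_speed hf).ht hU h).smul ((smooth_tau hf).ht hU h)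
  have h3 := eventually_t (H := fun t x => deriv (f t) x)
    (G := fun t x => speed f t x • tauF f t x) hU (fun t x h => deriv_eq_smul (f t) h) h
  have h4 := h1.unique (h2.congr_of_eventuallyEq h3)
  rw [dW h] at h4
  have h5 := dt_inner hU (smooth_tau hf) (smooth_tau hf) (fun t x h => tau_unit h) h
  rw [real_inner_comm] at h5
  have h6 : ⟪pT (tauF f) t x, tauF f t x⟫ = 0 := by linarith
  have h7 : pT (speed f) t x = speed f t x * etaF f t x := by
    have := congrArg (fun z => ⟪z, tauF f t x⟫) h4
    simp only [inner_add_left, real_inner_smul_left, h6, tau_unit h] at this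
    rw [etaF]; linarith
  refine ⟨h7, ?_⟩
  apply smul_right_injective _ (speed_ne h)
  simp only
  rw [smul_sub, h4, h7, smul_smul]
  abel

lemma time_kap (hf : ContDiff ℝ (⊤ : ℕ∞) (Function.uncurry f)) {t x : ℝ}
    (h : (t, x) ∈ regSet f) :
    speed f t x * ⟪kapF f t x, pT (kapF f) t x⟫ = ⟪kapF f t x, deriv (wF f t) x⟫
      - 2 * (speed f t x * etaF f t x * ⟪kapF f t x, kapF f t x⟫) := by
  have hU := regSet_open hf
  have h1 : HasDerivAt (fun s => deriv (tauF f s) x) (deriv (pT (tauF f) t) x) t := by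
    rw [← (smooth_tau hf).comm hU h]
    exact ((smooth_tau hf).dx hU).ht hU h
  have h2 := ((smooth_speed hf).ht hU h).smul ((smooth_kap hf).ht hU h)
  have h3 := eventually_t (H := fun t x => deriv (tauF f t) x)
    (G := fun t x => speed f t x • kapF f t x) hU (fun t x h => dtau h) h
  have h4 := h1.unique (h2.congr_of_eventuallyEq h3)
  have h5 := eventually_x (H := pT (tauF f))
    (G := fun t x => wF f t x - etaF f t x • tauF f t x) hU
    (fun t x h => (time_tau hf h).2) h
  have h6 := (((smooth_w hf).hx hU h).sub (((smooth_eta hf).hx hU h).smul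
    ((smooth_tau hf).hx hU h))).congr_of_eventuallyEq h5
  rw [h6.deriv, dtau h, (time_tau hf h).1] at h4
  have := congrArg (fun z => ⟪kapF f t x, z⟫) h4
  simp only [inner_add_right, inner_sub_right, real_inner_smul_right, kap_tau hf t x h] at this
  linarith

lemma density_evolution (l : ℝ) (hf : ContDiff ℝ (⊤ : ℕ∞) (Function.uncurry f)) {t x : ℝ}
    (h : (t, x) ∈ regSet f) :
    pT (densF l f) t x = deriv (fluxF l f t) x
      - ⟪-nab2F f t x - ((1 / 2 : ℝ) * ‖kapF f t x‖ ^ 2) • kapF f t x + l • kapF f t x,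
          pT f t x⟫ * speed f t x := by
  have hU := regSet_open hf
  have hk := (smooth_kap hf).ht hU h
  have hs := (smooth_speed hf).ht hU h
  have e1 : HasDerivAt (fun s => densF l f s x) _ t :=
    (((hk.inner ℝ hk).mul hs).const_mul (1 / 2 : ℝ)).add (hs.const_mul l)
  have kx := (smooth_kap hf).hx hU h
  have wx := (smooth_w hf).hx hU h
  have nx := (smooth_nab hf).hx hU h
  have Wx := (smooth_W hf).hx hU h
  have tx := (smooth_tau hf).hx hU h
  have e2 : HasDerivAt (fluxF l f t) _ x :=
    ((kx.inner ℝ wx).sub (nx.inner ℝ Wx)).sub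
      ((((kx.inner ℝ kx).const_mul (1 / 2 : ℝ)).sub_const l).mul (tx.inner ℝ Wx))
  have e1' : pT (densF l f) t x = _ := e1.deriv
  have hkd : deriv (kapF f t) x = speed f t x •
      (nabF f t x - ⟪kapF f t x, kapF f t x⟫ • tauF f t x) :=
    d_normal hf (smooth_kap hf) (kap_tau hf) h
  have hnd : deriv (nabF f t) x = speed f t x •
      (nab2F f t x - ⟪nabF f t x, kapF f t x⟫ • tauF f t x) :=
    d_normal hf (smooth_nab hf) (fun t x h => nabla_tau _ h) h
  have hkt := kap_tau hf t x h
  have htk := time_kap hf h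
  rw [e1', e2.deriv, hkd, hnd, dW h, dtau h, (time_tau hf h).1, ← real_inner_self_eq_norm_sq]
  rw [real_inner_comm (kapF f t x) (pT (kapF f) t x)]
  have heta : ⟪tauF f t x, wF f t x⟫ = etaF f t x := real_inner_comm _ _
  simp only [inner_add_left, inner_sub_left, inner_neg_left, inner_sub_right,
    real_inner_smul_left, real_inner_smul_right, hkt, heta,
    real_inner_comm (kapF f t x) (tauF f t x), real_inner_comm (kapF f t x) (nabF f t x)]
  linear_combination htk

lemma curve_energy (l : ℝ) (hf : ContDiff ℝ (⊤ : ℕ∞) (Function.uncurry f)) {T : ℝ}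
    {φ : ℝ → ℝ → ℝ}
    (hreg : ∀ t ∈ Ioo (0 : ℝ) T, ∀ x ∈ Icc (0 : ℝ) 1, deriv (f t) x ≠ 0)
    (hflow : ∀ t ∈ Ioo (0 : ℝ) T, ∀ x ∈ Icc (0 : ℝ) 1,
      pT f t x
        = -nablaS (f t) (nablaS (f t) (kappa (f t))) x
          - ((1 / 2 : ℝ) * ‖kappa (f t) x‖ ^ 2) • kappa (f t) x
          + l • kappa (f t) x
          + φ t x • tau (f t) x) {t : ℝ} (ht : t ∈ Ioo (0 : ℝ) T) :
    HasDerivAt (fun s => elasticELam l (f s))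
      (fluxF l f t 1 - fluxF l f t 0 -
        ∫ x in (0 : ℝ)..1, ‖pT f t x - φ t x • tau (f t) x‖ ^ 2 * ‖deriv (f t) x‖) t := by
  have hU := regSet_open hf
  have hsub : ∀ s ∈ Ioo (0 : ℝ) T, ∀ x ∈ Icc (0 : ℝ) 1, (s, x) ∈ regSet f := hreg
  have sec : ∀ (g : ℝ → ℝ → ℝ), SmoothU (regSet f) g → ∀ s ∈ Ioo (0 : ℝ) T,
      IntervalIntegrable (g s) volume 0 1 := fun g hg s hs =>
    ContinuousOn.intervalIntegrable (by
      rw [uIcc_of_le zero_le_one]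
      exact fun x hx => (hg.hx hU (hsub s hs x hx)).continuousAt.continuousWithinAt)
  have hI := hasDerivAt_int hU (smooth_dens l hf) ht hsub
  have hE : (fun s => elasticELam l (f s)) =ᶠ[nhds t]
      fun s => ∫ x in (0 : ℝ)..1, densF l f s x := by
    filter_upwards [isOpen_Ioo.mem_nhds ht] with s hs
    have hsm1 : SmoothU (regSet f) (fun t x => ⟪kapF f t x, kapF f t x⟫ * speed f t x) :=
      ContDiffOn.mul (smooth_inner (smooth_kap hf) (smooth_kap hf)) (smooth_speed hf)
    have i1 := sec _ hsm1 s hs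
    have i2 := sec _ (smooth_speed hf) s hs
    unfold densF
    rw [intervalIntegral.integral_add (i1.const_mul _) (i2.const_mul _),
      intervalIntegral.integral_const_mul, intervalIntegral.integral_const_mul]
    simp only [real_inner_self_eq_norm_sq]
    rfl
  refine (hI.congr_of_eventuallyEq hE).congr_deriv ?_
  have key : ∀ x ∈ Icc (0 : ℝ) 1, pT (densF l f) t x = deriv (fluxF l f t) x -
      ‖pT f t x - φ t x • tau (f t) x‖ ^ 2 * ‖deriv (f t) x‖ := by
    intro x hx
    have hp := hsub t ht x hx
    rw [density_evolution l hf hp]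
    have hfl : pT f t x = (-nab2F f t x - ((1 / 2 : ℝ) * ‖kapF f t x‖ ^ 2) • kapF f t x
      + l • kapF f t x) + φ t x • tauF f t x := hflow t ht x hx
    have hort : ⟪-nab2F f t x - ((1 / 2 : ℝ) * ‖kapF f t x‖ ^ 2) • kapF f t x
        + l • kapF f t x, tauF f t x⟫ = 0 := by
      have h2 : ⟪nab2F f t x, tauF f t x⟫ = 0 := nabla_tau _ hp
      simp [inner_add_left, inner_sub_left, real_inner_smul_left, kap_tau hf t x hp, h2]
    generalize -nab2F f t x - ((1 / 2 : ℝ) * ‖kapF f t x‖ ^ 2) • kapF f t x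
      + l • kapF f t x = V at *
    have h3 : pT f t x - φ t x • tau (f t) x = V := by
      rw [hfl]; exact add_sub_cancel_right _ _
    rw [h3, hfl, inner_add_right, real_inner_smul_right, hort, real_inner_self_eq_norm_sq]
    simp [speed]
  have key' : ∀ x ∈ uIcc (0 : ℝ) 1, ‖pT f t x - φ t x • tau (f t) x‖ ^ 2 * ‖deriv (f t) x‖
      = deriv (fluxF l f t) x - pT (densF l f) t x := by
    intro x hx
    rw [uIcc_of_le zero_le_one] at hx
    rw [key x hx]; ring
  have iF := sec _ ((smooth_flux l hf).dx hU) t ht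
  have iD := sec _ ((smooth_dens l hf).dt hU) t ht
  rw [intervalIntegral.integral_congr key', intervalIntegral.integral_sub iF iD,
    intervalIntegral.integral_eq_sub_of_hasDerivAt (f := fluxF l f t)
      (fun x hx => (smooth_flux l hf).hx hU (hsub t ht x (by
        rwa [uIcc_of_le zero_le_one] at hx))) iF]
  ring
end curve

/-- Along the elastic network flow with natural boundary conditions, the total energy
`Σᵢ E_{λᵢ}(fᵢ)` decreases:
`d/dt Σᵢ E_{λᵢ}(fᵢ) = − Σᵢ ∫₀¹ |∂ₜfᵢ − φᵢ ∂ₛfᵢ|² ds ≤ 0`. -/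
theorem network_energy_decreasing {n : ℕ} (hn : 2 ≤ n) (T : ℝ) (hT : 0 < T)
    (P : Fin 3 → EuclideanSpace ℝ (Fin n)) (hP : Function.Injective P)
    (lam : Fin 3 → ℝ) (hlam : ∀ i, 0 < lam i)
    (f : Fin 3 → ℝ → ℝ → EuclideanSpace ℝ (Fin n)) (φ : Fin 3 → ℝ → ℝ → ℝ)
    (hf : ∀ i, ContDiff ℝ (⊤ : ℕ∞) (Function.uncurry (f i)))
    (hφ : ∀ i, ContDiff ℝ (⊤ : ℕ∞) (Function.uncurry (φ i)))
    (hreg : ∀ i, ∀ t ∈ Ioo (0 : ℝ) T, ∀ x ∈ Icc (0 : ℝ) 1, deriv (f i t) x ≠ 0)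
    -- the elastic network flow
    (hflow : ∀ i, ∀ t ∈ Ioo (0 : ℝ) T, ∀ x ∈ Icc (0 : ℝ) 1,
      pT (f i) t x
        = -nablaS (f i t) (nablaS (f i t) (kappa (f i t))) x
          - ((1 / 2 : ℝ) * ‖kappa (f i t) x‖ ^ 2) • kappa (f i t) x
          + lam i • kappa (f i t) x
          + φ i t x • tau (f i t) x)
    -- boundary conditions
    (hfix : ∀ i, ∀ t ∈ Ioo (0 : ℝ) T, f i t 1 = P i)
    (hcurv : ∀ i, ∀ t ∈ Ioo (0 : ℝ) T,
      kappa (f i t) 0 = 0 ∧ kappa (f i t) 1 = 0)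
    (hconc : ∀ i j, ∀ t ∈ Ioo (0 : ℝ) T, f i t 0 = f j t 0)
    (hnat : ∀ t ∈ Ioo (0 : ℝ) T,
      ∑ i : Fin 3, (nablaS (f i t) (kappa (f i t)) 0 - lam i • tau (f i t) 0) = 0) :
    ∀ t ∈ Ioo (0 : ℝ) T,
      HasDerivAt (fun s => ∑ i : Fin 3, elasticELam (lam i) (f i s))
        (-∑ i : Fin 3,
          ∫ x in (0 : ℝ)..1,
            ‖pT (f i) t x - φ i t x • tau (f i t) x‖ ^ 2 * ‖deriv (f i t) x‖) t
      ∧ (-∑ i : Fin 3,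
          ∫ x in (0 : ℝ)..1,
            ‖pT (f i) t x - φ i t x • tau (f i t) x‖ ^ 2 * ‖deriv (f i t) x‖) ≤ 0 := by
  intro t ht
  constructor
  · have h1 : ∀ i ∈ (Finset.univ : Finset (Fin 3)), HasDerivAt
        (fun s => elasticELam (lam i) (f i s)) _ t :=
      fun i _ => curve_energy (lam i) (hf i) (hreg i) (hflow i) ht
    refine (HasDerivAt.fun_sum h1).congr_deriv ?_
    rw [Finset.sum_sub_distrib, sub_eq_add_neg, add_eq_right]
    have hW1 : ∀ i, pT (f i) t 1 = 0 := by
      intro i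
      have : (fun s => f i s 1) =ᶠ[nhds t] fun _ => P i := by
        filter_upwards [isOpen_Ioo.mem_nhds ht] with s hs using hfix i s hs
      exact ((hasDerivAt_const t (P i)).congr_of_eventuallyEq this).deriv
    have hW0 : ∀ i, pT (f i) t 0 = pT (f 0) t 0 := by
      intro i
      have : (fun s => f i s 0) =ᶠ[nhds t] fun s => f 0 s 0 := by
        filter_upwards [isOpen_Ioo.mem_nhds ht] with s hs using hconc i 0 s hs
      exact this.deriv_eq
    have hfl : ∀ i, fluxF (lam i) (f i) t 1 - fluxF (lam i) (f i) t 0 =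
        ⟪nablaS (f i t) (kappa (f i t)) 0 - lam i • tau (f i t) 0, pT (f 0) t 0⟫ := by
      intro i
      have k0 : kapF (f i) t 0 = 0 := (hcurv i t ht).1
      have k1 : kapF (f i) t 1 = 0 := (hcurv i t ht).2
      simp only [fluxF, k0, k1, hW1, hW0 i, inner_zero_left, inner_zero_right,
        inner_sub_left, real_inner_smul_left, nabF, tauF]
      ring
    rw [Finset.sum_congr rfl fun i _ => hfl i, ← sum_inner, hnat t ht, inner_zero_left]
  · rw [neg_nonpos]
    refine Finset.sum_nonneg fun i _ => ?_
    exact intervalIntegral.integral_nonneg zero_le_one fun x _ => by positivity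
end
end

section
/- Let f : [0,T) × [0,1] → ℝⁿ be a smooth solution of ∂ₜf = V + φτ, where V is the normal velocity and φ a smooth scalar function. Let ψ be a smooth normal vector field along f and set Y = ∇ₜψ + ∇ₛ⁴ψ. Then for all t ∈ (0,T): d/dt ( ½ ∫₀¹ |ψ|² ds ) + ∫₀¹ |∇ₛ²ψ|² ds = −[⟨ψ, ∇ₛ³ψ⟩]₀¹ + [⟨∇ₛψ, ∇ₛ²ψ⟩]₀¹ + ∫₀¹ ⟨Y + ½ ψ ∂ₛφ, ψ⟩ ds − ½ ∫₀¹ |ψ|² ⟨κ, V⟩ ds, where [g]₀¹ = g(1) − g(0). -/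
open Set MeasureTheory
open scoped RealInnerProductSpace

noncomputable section

/-- Iterated normal arc-length derivative `∇ₛ^m`. -/
def nablaSIter {n : ℕ} (f : ℝ → EuclideanSpace ℝ (Fin n)) :
    ℕ → (ℝ → EuclideanSpace ℝ (Fin n)) → ℝ → EuclideanSpace ℝ (Fin n)
  | 0, ψ => ψ
  | m + 1, ψ => nablaS f (nablaSIter f m ψ)

/-- Normal projection of the time derivative: `∇ₜψ = ∂ₜψ − ⟨∂ₜψ, τ⟩ τ`. -/
def nablaT {n : ℕ} (f ψ : ℝ → ℝ → EuclideanSpace ℝ (Fin n)) (t x : ℝ) :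
    EuclideanSpace ℝ (Fin n) :=
  pT ψ t x - ⟪pT ψ t x, tau (f t) x⟫ • tau (f t) x

section helpers

variable {n : ℕ}


lemma cl_hasDerivAt_fst {F : Type*} [NormedAddCommGroup F] [NormedSpace ℝ F]
    {G : ℝ → ℝ → F} (hG : ContDiff ℝ (⊤ : ℕ∞) (Function.uncurry G)) (s x : ℝ) :
    HasDerivAt (fun s => G s x) (fderiv ℝ (Function.uncurry G) (s, x) (1, 0)) s := by
  have h1 : HasFDerivAt (Function.uncurry G) (fderiv ℝ (Function.uncurry G) (s, x)) (s, x) :=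
    (hG.differentiable (by simp) _).hasFDerivAt
  have h2 : HasDerivAt (fun s : ℝ => (s, x)) ((1 : ℝ), (0 : ℝ)) s :=
    (hasDerivAt_id s).prodMk (hasDerivAt_const s x)
  exact h1.comp_hasDerivAt s h2

lemma cl_hasDerivAt_snd {F : Type*} [NormedAddCommGroup F] [NormedSpace ℝ F]
    {G : ℝ → ℝ → F} (hG : ContDiff ℝ (⊤ : ℕ∞) (Function.uncurry G)) (s x : ℝ) :
    HasDerivAt (G s) (fderiv ℝ (Function.uncurry G) (s, x) (0, 1)) x := by
  have h1 : HasFDerivAt (Function.uncurry G) (fderiv ℝ (Function.uncurry G) (s, x)) (s, x) :=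
    (hG.differentiable (by simp) _).hasFDerivAt
  have h2 : HasDerivAt (fun x : ℝ => (s, x)) ((0 : ℝ), (1 : ℝ)) x :=
    (hasDerivAt_const x s).prodMk (hasDerivAt_id x)
  exact h1.comp_hasDerivAt x h2

lemma cl_contDiff_pT {F : Type*} [NormedAddCommGroup F] [NormedSpace ℝ F]
    {G : ℝ → ℝ → F} (hG : ContDiff ℝ (⊤ : ℕ∞) (Function.uncurry G)) :
    ContDiff ℝ (⊤ : ℕ∞) (Function.uncurry (pT G)) := by
  have : Function.uncurry (pT G) = fun p => fderiv ℝ (Function.uncurry G) p (1, 0) := by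
    ext1 ⟨s, x⟩
    exact (cl_hasDerivAt_fst hG s x).deriv
  rw [this]
  exact (hG.fderiv_right (m := (⊤ : ℕ∞)) (by simp)).clm_apply contDiff_const

lemma cl_contDiff_dx {F : Type*} [NormedAddCommGroup F] [NormedSpace ℝ F]
    {G : ℝ → ℝ → F} (hG : ContDiff ℝ (⊤ : ℕ∞) (Function.uncurry G)) :
    ContDiff ℝ (⊤ : ℕ∞) (Function.uncurry (fun s => deriv (G s))) := by
  have : Function.uncurry (fun s => deriv (G s))
      = fun p => fderiv ℝ (Function.uncurry G) p (0, 1) := by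
    ext1 ⟨s, x⟩
    exact (cl_hasDerivAt_snd hG s x).deriv
  rw [this]
  exact (hG.fderiv_right (m := (⊤ : ℕ∞)) (by simp)).clm_apply contDiff_const

lemma cl_symm {F : Type*} [NormedAddCommGroup F] [NormedSpace ℝ F]
    {G : ℝ → ℝ → F} (hG : ContDiff ℝ (⊤ : ℕ∞) (Function.uncurry G)) (t x : ℝ) :
    pT (fun s => deriv (G s)) t x = deriv (pT G t) x := by
  have hsym : IsSymmSndFDerivAt ℝ (Function.uncurry G) (t, x) :=
    (hG.contDiffAt).isSymmSndFDerivAt (by simp only [minSmoothness_of_isRCLikeNormedField]; exact WithTop.coe_le_coe.2 (le_top : (2 : ℕ∞) ≤ ⊤))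
  have hd : HasFDerivAt (fderiv ℝ (Function.uncurry G))
      (fderiv ℝ (fderiv ℝ (Function.uncurry G)) (t, x)) (t, x) :=
    ((hG.fderiv_right (m := (⊤ : ℕ∞)) (by simp)).differentiable (by simp) _).hasFDerivAt
  have h2 : HasDerivAt (fun x : ℝ => (t, x)) ((0 : ℝ), (1 : ℝ)) x :=
    (hasDerivAt_const x t).prodMk (hasDerivAt_id x)
  have h1 : HasDerivAt (fun s : ℝ => (s, x)) ((1 : ℝ), (0 : ℝ)) t :=
    (hasDerivAt_id t).prodMk (hasDerivAt_const t x)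
  have e1 : (fun s => deriv (G s) x) = fun s => fderiv ℝ (Function.uncurry G) (s, x) (0, 1) := by
    ext1 s; exact (cl_hasDerivAt_snd hG s x).deriv
  have e2 : pT G t = fun x => fderiv ℝ (Function.uncurry G) (t, x) (1, 0) := by
    ext1 y; exact (cl_hasDerivAt_fst hG t y).deriv
  have k1 : HasDerivAt (fun s => fderiv ℝ (Function.uncurry G) (s, x) (0, 1))
      (fderiv ℝ (fderiv ℝ (Function.uncurry G)) (t, x) (1, 0) (0, 1)) t :=
    ((ContinuousLinearMap.apply ℝ F ((0 : ℝ), (1 : ℝ))).hasFDerivAt).comp_hasDerivAt t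
      (hd.comp_hasDerivAt t h1)
  have k2 : HasDerivAt (fun y => fderiv ℝ (Function.uncurry G) (t, y) (1, 0))
      (fderiv ℝ (fderiv ℝ (Function.uncurry G)) (t, x) (0, 1) (1, 0)) x :=
    ((ContinuousLinearMap.apply ℝ F ((1 : ℝ), (0 : ℝ))).hasFDerivAt).comp_hasDerivAt x
      (hd.comp_hasDerivAt x h2)
  rw [e2]
  simp only [pT]
  rw [e1, k1.deriv, k2.deriv]
  exact hsym _ _

/-- regular set -/
def clU (γ : ℝ → EuclideanSpace ℝ (Fin n)) : Set ℝ := {x | deriv γ x ≠ 0}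

lemma clU_open {γ : ℝ → EuclideanSpace ℝ (Fin n)} (hγ : ContDiff ℝ (⊤ : ℕ∞) γ) : IsOpen (clU γ) :=
  isOpen_ne_fun (hγ.continuous_deriv (by simp)) continuous_const

lemma cl_sDeriv {F : Type*} [NormedAddCommGroup F] [NormedSpace ℝ F]
    {γ : ℝ → EuclideanSpace ℝ (Fin n)} (hγ : ContDiff ℝ (⊤ : ℕ∞) γ) {g : ℝ → F}
    (hg : ContDiffOn ℝ (⊤ : ℕ∞) g (clU γ)) :
    ContDiffOn ℝ (⊤ : ℕ∞) (sDeriv γ g) (clU γ) := by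
  have h1 : ContDiffOn ℝ (⊤ : ℕ∞) (deriv γ) (clU γ) :=
    hγ.contDiffOn.deriv_of_isOpen (clU_open hγ) (by simp)
  have h2 : ContDiffOn ℝ (⊤ : ℕ∞) (deriv g) (clU γ) :=
    hg.deriv_of_isOpen (clU_open hγ) (by simp)
  exact ((h1.norm ℝ (fun x hx => hx)).inv (fun x hx => norm_ne_zero_iff.2 hx)).smul h2

lemma cl_tau {γ : ℝ → EuclideanSpace ℝ (Fin n)} (hγ : ContDiff ℝ (⊤ : ℕ∞) γ) :
    ContDiffOn ℝ (⊤ : ℕ∞) (tau γ) (clU γ) := cl_sDeriv hγ hγ.contDiffOn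

lemma cl_nablaS {γ g : ℝ → EuclideanSpace ℝ (Fin n)} (hγ : ContDiff ℝ (⊤ : ℕ∞) γ)
    (hg : ContDiffOn ℝ (⊤ : ℕ∞) g (clU γ)) :
    ContDiffOn ℝ (⊤ : ℕ∞) (nablaS γ g) (clU γ) := by
  have h1 := cl_sDeriv hγ hg
  have h2 := cl_tau hγ
  exact h1.sub ((h1.inner ℝ h2).smul h2)

lemma cl_iter {γ g : ℝ → EuclideanSpace ℝ (Fin n)} (hγ : ContDiff ℝ (⊤ : ℕ∞) γ)
    (hg : ContDiffOn ℝ (⊤ : ℕ∞) g (clU γ)) (k : ℕ) :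
    ContDiffOn ℝ (⊤ : ℕ∞) (nablaSIter γ k g) (clU γ) := by
  induction k with
  | zero => exact hg
  | succ k ih => exact cl_nablaS hγ ih

lemma cl_tau_unit {γ : ℝ → EuclideanSpace ℝ (Fin n)} {x : ℝ} (hx : deriv γ x ≠ 0) : ⟪tau γ x, tau γ x⟫ = 1 := by
  have : ‖deriv γ x‖ ≠ 0 := norm_ne_zero_iff.2 hx
  simp only [tau, sDeriv, inner_smul_left, inner_smul_right, real_inner_self_eq_norm_sq]
  simp
  field_simp

lemma cl_nablaS_normal {γ g : ℝ → EuclideanSpace ℝ (Fin n)} {x : ℝ} (hx : deriv γ x ≠ 0) :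
    ⟪nablaS γ g x, tau γ x⟫ = 0 := by
  simp [nablaS, inner_sub_left, inner_smul_left, cl_tau_unit hx, -inner_self_eq_norm_sq_to_K]

lemma cl_nablaS_inner {γ g : ℝ → EuclideanSpace ℝ (Fin n)} {x : ℝ} (hx : deriv γ x ≠ 0) {X : EuclideanSpace ℝ (Fin n)}
    (hX : ⟪X, tau γ x⟫ = 0) : ⟪nablaS γ g x, X⟫ * ‖deriv γ x‖ = ⟪deriv g x, X⟫ := by
  have : ‖deriv γ x‖ ≠ 0 := norm_ne_zero_iff.2 hx
  rw [nablaS, inner_sub_left, inner_smul_left, real_inner_comm X (tau γ x), hX]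
  simp only [sDeriv, inner_smul_left]
  simp
  field_simp

lemma cl_intble {g : ℝ → ℝ} {U : Set ℝ} (hU : Icc (0 : ℝ) 1 ⊆ U) (hg : ContinuousOn g U) :
    IntervalIntegrable g volume 0 1 := by
  apply ContinuousOn.intervalIntegrable
  rw [uIcc_of_le zero_le_one]
  exact hg.mono hU

lemma cl_parts {γ X Z : ℝ → EuclideanSpace ℝ (Fin n)} (hγ : ContDiff ℝ (⊤ : ℕ∞) γ)
    (hreg : Icc (0 : ℝ) 1 ⊆ clU γ)
    (hX : ContDiffOn ℝ (⊤ : ℕ∞) X (clU γ)) (hZ : ContDiffOn ℝ (⊤ : ℕ∞) Z (clU γ))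
    (nX : ∀ x ∈ Icc (0 : ℝ) 1, ⟪X x, tau γ x⟫ = 0)
    (nZ : ∀ x ∈ Icc (0 : ℝ) 1, ⟪Z x, tau γ x⟫ = 0) :
    ∫ x in (0 : ℝ)..1, ⟪nablaS γ Z x, X x⟫ * ‖deriv γ x‖ =
      (⟪Z 1, X 1⟫ - ⟪Z 0, X 0⟫) - ∫ x in (0 : ℝ)..1, ⟪Z x, nablaS γ X x⟫ * ‖deriv γ x‖ := by
  have hc : ContinuousOn (fun x => ‖deriv γ x‖) (clU γ) :=
    (hγ.continuous_deriv (by simp)).norm.continuousOn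
  have i1 : IntervalIntegrable (fun x => ⟪nablaS γ Z x, X x⟫ * ‖deriv γ x‖) volume 0 1 :=
    cl_intble hreg (((cl_nablaS hγ hZ).continuousOn.inner hX.continuousOn).mul hc)
  have i2 : IntervalIntegrable (fun x => ⟪Z x, nablaS γ X x⟫ * ‖deriv γ x‖) volume 0 1 :=
    cl_intble hreg ((hZ.continuousOn.inner (cl_nablaS hγ hX).continuousOn).mul hc)
  rw [eq_sub_iff_add_eq, ← intervalIntegral.integral_add i1 i2]
  apply intervalIntegral.integral_eq_sub_of_hasDerivAt (f := fun x => ⟪Z x, X x⟫) _ (i1.add i2)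
  intro x hx
  rw [uIcc_of_le zero_le_one] at hx
  have hxU := (clU_open hγ).mem_nhds (hreg hx)
  have dX := ((hX.contDiffAt hxU).differentiableAt (by simp)).hasDerivAt
  have dZ := ((hZ.contDiffAt hxU).differentiableAt (by simp)).hasDerivAt
  convert! dZ.inner ℝ dX using 1
  rw [cl_nablaS_inner (hreg hx) (nX x hx), ← real_inner_comm (Z x), cl_nablaS_inner (hreg hx) (nZ x hx),
    add_comm, ← real_inner_comm (Z x)]

lemma cl_speed {γ V W : ℝ → EuclideanSpace ℝ (Fin n)} {φ : ℝ → ℝ} (hγ : ContDiff ℝ (⊤ : ℕ∞) γ)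
    (hV : ContDiff ℝ (⊤ : ℕ∞) V) (hφ : ContDiff ℝ (⊤ : ℕ∞) φ)
    (hreg : Icc (0 : ℝ) 1 ⊆ clU γ)
    (hn : ∀ x ∈ Icc (0 : ℝ) 1, ⟪V x, tau γ x⟫ = 0)
    (hW : ∀ x ∈ Icc (0 : ℝ) 1, W x = V x + φ x • tau γ x) {x : ℝ} (hx : x ∈ Ioo (0 : ℝ) 1) :
    ⟪deriv γ x, deriv W x⟫ / ‖deriv γ x‖
      = ‖deriv γ x‖ * (sDeriv γ φ x - ⟪kappa γ x, V x⟫) := by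
  have hxI := Ioo_subset_Icc_self hx
  have hr := hreg hxI
  have hw : ‖deriv γ x‖ ≠ 0 := norm_ne_zero_iff.2 hr
  have hxU := (clU_open hγ).mem_nhds hr
  have hI : Icc (0 : ℝ) 1 ∈ nhds x := Icc_mem_nhds hx.1 hx.2
  have dτ := (((cl_tau hγ).contDiffAt hxU).differentiableAt (by simp)).hasDerivAt
  have dV := (hV.differentiable (by simp) x).hasDerivAt
  have dφ := (hφ.differentiable (by simp) x).hasDerivAt
  have eW : deriv W x = deriv V x + (φ x • deriv (tau γ) x + deriv φ x • tau γ x) := by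
    have : W =ᶠ[nhds x] fun x => V x + φ x • tau γ x := by
      filter_upwards [hI] with y hy using hW y hy
    rw [this.deriv_eq]
    exact (dV.add (dφ.smul dτ)).deriv
  have e1 : ⟪V x, deriv (tau γ) x⟫ + ⟪deriv V x, tau γ x⟫ = 0 := by
    have : (fun x => ⟪V x, tau γ x⟫) =ᶠ[nhds x] fun _ => (0 : ℝ) := by
      filter_upwards [hI] with y hy using hn y hy
    rw [← (dV.inner ℝ dτ).deriv, this.deriv_eq]
    simp
  have e2 : ⟪tau γ x, deriv (tau γ) x⟫ + ⟪deriv (tau γ) x, tau γ x⟫ = 0 := by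
    have : (fun x => ⟪tau γ x, tau γ x⟫) =ᶠ[nhds x] fun _ => (1 : ℝ) := by
      filter_upwards [hxU] with y hy using cl_tau_unit hy
    rw [← (dτ.inner ℝ dτ).deriv, this.deriv_eq]
    simp
  rw [real_inner_comm] at e2
  have e3 : ⟪deriv (tau γ) x, tau γ x⟫ = 0 := by linarith
  have e4 : deriv γ x = ‖deriv γ x‖ • tau γ x := by
    simp [tau, sDeriv, smul_smul, hw]
  have e5 : ⟪deriv γ x, deriv W x⟫ = ‖deriv γ x‖ * (deriv φ x - ⟪deriv (tau γ) x, V x⟫) := by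
    conv_lhs => rw [e4]
    rw [real_inner_smul_left, real_inner_comm, eW, inner_add_left, inner_add_left,
      real_inner_smul_left, real_inner_smul_left, e3, cl_tau_unit hr]
    rw [real_inner_comm] at e1
    congr 1
    linarith
  rw [e5]
  simp only [kappa, sDeriv, real_inner_smul_left, smul_eq_mul]
  field_simp

lemma cl_time {a c : ℝ → ℝ → EuclideanSpace ℝ (Fin n)} (ha : ContDiff ℝ (⊤ : ℕ∞) (Function.uncurry a))
    (hc : ContDiff ℝ (⊤ : ℕ∞) (Function.uncurry c)) {T t : ℝ} (ht : t ∈ Ioo (0 : ℝ) T)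
    (hreg : ∀ s ∈ Ico (0 : ℝ) T, ∀ x ∈ Icc (0 : ℝ) 1, c s x ≠ 0) :
    HasDerivAt (fun s => ∫ x in (0 : ℝ)..1, ‖a s x‖ ^ 2 * ‖c s x‖)
      (∫ x in (0 : ℝ)..1, (2 * ⟪a t x, pT a t x⟫ * ‖c t x‖
        + ‖a t x‖ ^ 2 * (⟪c t x, pT c t x⟫ / ‖c t x‖))) t := by
  set F' : ℝ → ℝ → ℝ := fun s x => 2 * ⟪a s x, pT a s x⟫ * ‖c s x‖
        + ‖a s x‖ ^ 2 * (⟪c s x, pT c s x⟫ / ‖c s x‖) with hF'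
  obtain ⟨p, hp0, hpt⟩ := exists_between ht.1
  obtain ⟨q, htq, hqT⟩ := exists_between ht.2
  have hsub : Icc p q ⊆ Ico 0 T := fun s hs => ⟨hp0.le.trans hs.1, hs.2.trans_lt hqT⟩
  have ca : Continuous (fun z : ℝ × ℝ => a z.1 z.2) := ha.continuous
  have cc : Continuous (fun z : ℝ × ℝ => c z.1 z.2) := hc.continuous
  have cpa : Continuous (fun z : ℝ × ℝ => pT a z.1 z.2) := (cl_contDiff_pT ha).continuous
  have cpc : Continuous (fun z : ℝ × ℝ => pT c z.1 z.2) := (cl_contDiff_pT hc).continuous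
  have hcont : ContinuousOn (fun z : ℝ × ℝ => F' z.1 z.2) (Icc p q ×ˢ Icc (0 : ℝ) 1) := by
    apply ContinuousOn.add
    · exact (((continuous_const.mul (ca.inner cpa)).mul cc.norm)).continuousOn
    · apply (ca.norm.pow 2).continuousOn.mul
      apply (cc.inner cpc).continuousOn.div cc.norm.continuousOn
      intro z hz
      exact norm_ne_zero_iff.2 (hreg _ (hsub hz.1) _ hz.2)
  obtain ⟨C, hC⟩ := (isCompact_Icc.prod isCompact_Icc).exists_bound_of_continuousOn hcont
  have cas : ∀ s, Continuous (a s) := fun s => ca.comp (g := fun z : ℝ × ℝ => a z.1 z.2)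
    (Continuous.prodMk_right s)
  have ccs : ∀ s, Continuous (c s) := fun s => cc.comp (g := fun z : ℝ × ℝ => c z.1 z.2)
    (Continuous.prodMk_right s)
  have hcs : ∀ s, Continuous (fun x => ‖a s x‖ ^ 2 * ‖c s x‖) := fun s =>
    ((cas s).norm.pow 2).mul (ccs s).norm
  have hF't : IntervalIntegrable (F' t) volume 0 1 := by
    have hm : MapsTo (fun x : ℝ => (t, x)) (Icc 0 1) (Icc p q ×ˢ Icc (0 : ℝ) 1) :=
      fun x hx => ⟨⟨hpt.le, htq.le⟩, hx⟩
    have h := ContinuousOn.comp (g := fun z : ℝ × ℝ => F' z.1 z.2) hcont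
      (Continuous.prodMk_right t).continuousOn hm
    exact cl_intble subset_rfl h
  refine (intervalIntegral.hasDerivAt_integral_of_dominated_loc_of_deriv_le
    (F' := F') (s := Icc p q) (bound := fun _ => C)
    (Icc_mem_nhds hpt htq) (Filter.Eventually.of_forall fun s => (hcs s).aestronglyMeasurable)
    ((hcs t).intervalIntegrable _ _) ?_ ?_ intervalIntegrable_const ?_).2
  · exact (intervalIntegrable_iff.1 hF't).aestronglyMeasurable
  · refine Filter.Eventually.of_forall fun x hx s hs => ?_
    rw [uIoc_of_le zero_le_one] at hx
    exact hC (s, x) ⟨hs, Ioc_subset_Icc_self hx⟩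
  · refine Filter.Eventually.of_forall fun x hx s hs => ?_
    rw [uIoc_of_le zero_le_one] at hx
    have hne := hreg s (hsub hs) x (Ioc_subset_Icc_self hx)
    have da : HasDerivAt (fun s => a s x) (pT a s x) s :=
      (cl_hasDerivAt_fst ha s x).differentiableAt.hasDerivAt
    have dc : HasDerivAt (fun s => c s x) (pT c s x) s :=
      (cl_hasDerivAt_fst hc s x).differentiableAt.hasDerivAt
    have dn : HasDerivAt (fun s => ‖c s x‖) (⟪c s x, pT c s x⟫ / ‖c s x‖) s := by
      have h := (dc.norm_sq).sqrt (by simpa using hne)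
      simp only [Real.sqrt_sq (norm_nonneg _)] at h
      convert! h using 1
      have : ‖c s x‖ ≠ 0 := norm_ne_zero_iff.2 hne
      field_simp
    exact da.norm_sq.mul dn

lemma cl_slice {F : Type*} [NormedAddCommGroup F] [NormedSpace ℝ F]
    {G : ℝ → ℝ → F} (hG : ContDiff ℝ (⊤ : ℕ∞) (Function.uncurry G)) (t : ℝ) :
    ContDiff ℝ (⊤ : ℕ∞) (G t) :=
  ContDiff.comp (g := Function.uncurry G) (f := fun x : ℝ => (t, x)) hG
    (contDiff_const.prodMk contDiff_id)

end helpers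

/-- The "crucial lemma": along the flow `∂ₜ f = V + φ τ`, for any normal field `ψ`, with
`Y = ∇ₜψ + ∇ₛ⁴ψ`,
`d/dt (½∫|ψ|² ds) + ∫|∇ₛ²ψ|² ds = −[⟨ψ, ∇ₛ³ψ⟩]₀¹ + [⟨∇ₛψ, ∇ₛ²ψ⟩]₀¹
  + ∫⟨Y + ½ ∂ₛφ ψ, ψ⟩ ds − ½∫|ψ|²⟨κ, V⟩ ds`. -/
theorem crucial_lemma {n : ℕ} (hn : 2 ≤ n) (T : ℝ) (hT : 0 < T)
    (f V : ℝ → ℝ → EuclideanSpace ℝ (Fin n)) (φ : ℝ → ℝ → ℝ)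
    (hf : ContDiff ℝ (⊤ : ℕ∞) (Function.uncurry f))
    (hV : ContDiff ℝ (⊤ : ℕ∞) (Function.uncurry V))
    (hφ : ContDiff ℝ (⊤ : ℕ∞) (Function.uncurry φ))
    (hreg : ∀ t ∈ Ico (0 : ℝ) T, ∀ x ∈ Icc (0 : ℝ) 1, deriv (f t) x ≠ 0)
    (hnormal : ∀ t ∈ Ico (0 : ℝ) T, ∀ x ∈ Icc (0 : ℝ) 1, ⟪V t x, tau (f t) x⟫ = 0)
    (hflow : ∀ t ∈ Ico (0 : ℝ) T, ∀ x ∈ Icc (0 : ℝ) 1,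
      pT f t x = V t x + φ t x • tau (f t) x)
    (ψ : ℝ → ℝ → EuclideanSpace ℝ (Fin n))
    (hψ : ContDiff ℝ (⊤ : ℕ∞) (Function.uncurry ψ))
    (hψnormal : ∀ t ∈ Ico (0 : ℝ) T, ∀ x ∈ Icc (0 : ℝ) 1, ⟪ψ t x, tau (f t) x⟫ = 0) :
    ∀ t ∈ Ioo (0 : ℝ) T,
      HasDerivAt
        (fun s => (1 / 2 : ℝ) * ∫ x in (0 : ℝ)..1, ‖ψ s x‖ ^ 2 * ‖deriv (f s) x‖)
        (-(⟪ψ t 1, nablaSIter (f t) 3 (ψ t) 1⟫ - ⟪ψ t 0, nablaSIter (f t) 3 (ψ t) 0⟫)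
          + (⟪nablaSIter (f t) 1 (ψ t) 1, nablaSIter (f t) 2 (ψ t) 1⟫
              - ⟪nablaSIter (f t) 1 (ψ t) 0, nablaSIter (f t) 2 (ψ t) 0⟫)
          + (∫ x in (0 : ℝ)..1,
              ⟪(nablaT f ψ t x + nablaSIter (f t) 4 (ψ t) x)
                  + ((1 / 2 : ℝ) * sDeriv (f t) (φ t) x) • ψ t x, ψ t x⟫
                * ‖deriv (f t) x‖)
          - (1 / 2 : ℝ) * (∫ x in (0 : ℝ)..1,
              ‖ψ t x‖ ^ 2 * ⟪kappa (f t) x, V t x⟫ * ‖deriv (f t) x‖)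
          - ∫ x in (0 : ℝ)..1, ‖nablaSIter (f t) 2 (ψ t) x‖ ^ 2 * ‖deriv (f t) x‖) t := by
  intro t ht
  have htI : t ∈ Ico (0 : ℝ) T := ⟨ht.1.le, ht.2⟩
  have hγ := cl_slice hf t
  have hP := cl_slice hψ t
  have hU : Icc (0 : ℝ) 1 ⊆ clU (f t) := fun x hx => hreg t htI x hx
  have hN := cl_iter hγ hP.contDiffOn (g := ψ t)
  have nP := hψnormal t htI
  have nN : ∀ k, ∀ x ∈ Icc (0 : ℝ) 1, ⟪nablaSIter (f t) (k + 1) (ψ t) x, tau (f t) x⟫ = 0 :=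
    fun k x hx => cl_nablaS_normal (hU hx)
  have p1 := cl_parts hγ hU hP.contDiffOn (hN 3) nP (nN 2)
  have p2 := cl_parts hγ hU (hN 1) (hN 2) (nN 0) (nN 1)
  have main := (cl_time hψ (cl_contDiff_dx hf) ht hreg).const_mul (1 / 2 : ℝ)
  have hc : ContinuousOn (fun x => ‖deriv (f t) x‖) (clU (f t)) :=
    (hγ.continuous_deriv (by simp)).norm.continuousOn
  have cP : ContinuousOn (ψ t) (clU (f t)) := hP.continuous.continuousOn
  have cτ := (cl_tau hγ).continuousOn
  have cpT : ContinuousOn (pT ψ t) (clU (f t)) := (cl_slice (cl_contDiff_pT hψ) t).continuous.continuousOn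
  have cφ : ContinuousOn (sDeriv (f t) (φ t)) (clU (f t)) :=
    (cl_sDeriv hγ (cl_slice hφ t).contDiffOn).continuousOn
  have cκ : ContinuousOn (kappa (f t)) (clU (f t)) := (cl_sDeriv hγ (cl_tau hγ)).continuousOn
  have cV : ContinuousOn (V t) (clU (f t)) := (cl_slice hV t).continuous.continuousOn
  have c1 : ContinuousOn (fun x => ⟪pT ψ t x, tau (f t) x⟫) (clU (f t)) := cpT.inner cτ
  have cT : ContinuousOn (fun x => nablaT f ψ t x) (clU (f t)) := by
    unfold nablaT
    exact cpT.sub (c1.smul cτ)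
  have c0 : ContinuousOn (fun x => (1 / 2 : ℝ) * sDeriv (f t) (φ t) x) (clU (f t)) :=
    continuousOn_const.mul cφ
  have c2 : ContinuousOn (fun x => ((1 / 2 : ℝ) * sDeriv (f t) (φ t) x) • ψ t x) (clU (f t)) :=
    c0.smul cP
  have iA : IntervalIntegrable (fun x => ⟪(nablaT f ψ t x + nablaSIter (f t) 4 (ψ t) x)
                  + ((1 / 2 : ℝ) * sDeriv (f t) (φ t) x) • ψ t x, ψ t x⟫
                * ‖deriv (f t) x‖) volume 0 1 :=
    cl_intble hU (((((cT.add (hN 4).continuousOn).add c2).inner cP)).mul hc)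
  have iB : IntervalIntegrable (fun x => ‖ψ t x‖ ^ 2 * ⟪kappa (f t) x, V t x⟫ * ‖deriv (f t) x‖)
      volume 0 1 :=
    cl_intble hU (((cP.norm.pow 2).mul (cκ.inner cV)).mul hc)
  have iD : IntervalIntegrable (fun x => ⟪nablaSIter (f t) 4 (ψ t) x, ψ t x⟫ * ‖deriv (f t) x‖)
      volume 0 1 :=
    cl_intble hU (((hN 4).continuousOn.inner cP).mul hc)
  convert! main using 1
  rw [← intervalIntegral.integral_const_mul (1 / 2 : ℝ) (fun x => 2 * _ * _ + _)]
  have key : ∫ x in (0 : ℝ)..1, (1 / 2 : ℝ) * (2 * ⟪ψ t x, pT ψ t x⟫ * ‖deriv (f t) x‖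
        + ‖ψ t x‖ ^ 2 * (⟪deriv (f t) x, pT (fun s => deriv (f s)) t x⟫ / ‖deriv (f t) x‖))
      = ∫ x in (0 : ℝ)..1, ((⟪(nablaT f ψ t x + nablaSIter (f t) 4 (ψ t) x)
                  + ((1 / 2 : ℝ) * sDeriv (f t) (φ t) x) • ψ t x, ψ t x⟫
                * ‖deriv (f t) x‖) -
          (1 / 2 : ℝ) * (‖ψ t x‖ ^ 2 * ⟪kappa (f t) x, V t x⟫ * ‖deriv (f t) x‖)
          - ⟪nablaSIter (f t) 4 (ψ t) x, ψ t x⟫ * ‖deriv (f t) x‖) := by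
    apply intervalIntegral.integral_congr_Ioo_of_le zero_le_one
    intro x hx
    have hs := cl_speed hγ (cl_slice hV t) (cl_slice hφ t) hU (hnormal t htI) (hflow t htI) hx
    simp only
    rw [cl_symm hf, hs]
    have hn := nP x (Ioo_subset_Icc_self hx)
    rw [real_inner_comm] at hn
    simp only [inner_add_left, real_inner_smul_left, nablaT, inner_sub_left, hn,
      real_inner_self_eq_norm_sq]
    rw [real_inner_comm (pT ψ t x) (ψ t x)]
    ring
  rw [key, intervalIntegral.integral_sub (iA.sub (iB.const_mul _)) iD,
    intervalIntegral.integral_sub iA (iB.const_mul _), intervalIntegral.integral_const_mul]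
  have q : ∫ x in (0 : ℝ)..1, ⟪nablaSIter (f t) 3 (ψ t) x, nablaS (f t) (ψ t) x⟫ * ‖deriv (f t) x‖
     = ∫ x in (0 : ℝ)..1, ⟪nablaS (f t) (nablaSIter (f t) 2 (ψ t)) x, nablaSIter (f t) 1 (ψ t) x⟫
        * ‖deriv (f t) x‖ := rfl
  have q1 : ∫ x in (0 : ℝ)..1, ⟪nablaSIter (f t) 4 (ψ t) x, ψ t x⟫ * ‖deriv (f t) x‖
     = ∫ x in (0 : ℝ)..1, ⟪nablaS (f t) (nablaSIter (f t) 3 (ψ t)) x, ψ t x⟫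
        * ‖deriv (f t) x‖ := rfl
  have q2 : ∫ x in (0 : ℝ)..1, ⟪nablaSIter (f t) 2 (ψ t) x,
        nablaS (f t) (nablaSIter (f t) 1 (ψ t)) x⟫ * ‖deriv (f t) x‖
     = ∫ x in (0 : ℝ)..1, ‖nablaSIter (f t) 2 (ψ t) x‖ ^ 2 * ‖deriv (f t) x‖ := by
    congr 1
    ext1 x
    rw [← real_inner_self_eq_norm_sq]
    rfl
  rw [q1, p1, q, p2, q2, real_inner_comm (ψ t 1), real_inner_comm (ψ t 0),
    real_inner_comm (nablaSIter (f t) 1 (ψ t) 1), real_inner_comm (nablaSIter (f t) 1 (ψ t) 0)]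
  ring
end
end

section
/- Let f : [0,1] → ℝⁿ be a regular smooth curve with curvature vector κ. Let a, c, ℓ ∈ ℕ₀ and b ∈ ℕ with b ≥ 2, c ≤ ℓ+2 and a < 2(ℓ+2). Then there is a constant C = C(n, ℓ, a, b) such that for all i₁, …, i_b ∈ ℕ₀ with i₁ + … + i_b = a and max_j i_j ≤ c, one has ∫₀¹ ∏_{j=1}^{b} |∇ₛ^{i_j} κ| ds ≤ C · L(f)^{1 − a − b} · ‖κ‖₂^{b − γ} · ‖κ‖_{ℓ+2,2}^{γ}, where γ = (a + b/2 − 1)/(ℓ+2) and the norms are the scale-invariant norms. -/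
open Set MeasureTheory
open scoped RealInnerProductSpace

noncomputable section

/-- Scale-invariant norm `‖∇ₛⁱκ‖_p = L(f)^{i+1-1/p} (∫₀¹ |∇ₛⁱκ|^p ds)^{1/p}`. -/
def knorm {n : ℕ} (f : ℝ → EuclideanSpace ℝ (Fin n)) (i : ℕ) (p : ℝ) : ℝ :=
  curveLen f ^ ((i : ℝ) + 1 - 1 / p) *
    (∫ x in (0 : ℝ)..1, ‖nablaSIter f i (kappa f) x‖ ^ p * ‖deriv f x‖) ^ (1 / p)

/-- Scale-invariant norm `‖κ‖_{k,p} = Σ_{i=0}^{k} ‖∇ₛⁱκ‖_p`. -/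
def knormSum {n : ℕ} (f : ℝ → EuclideanSpace ℝ (Fin n)) (k : ℕ) (p : ℝ) : ℝ :=
  ∑ i ∈ Finset.range (k + 1), knorm f i p


lemma pti_cs (v g h : ℝ → ℝ) (hv : ContinuousOn v (Icc 0 1)) (hv0 : ∀ x ∈ Icc (0:ℝ) 1, 0 ≤ v x)
    (hg : ContinuousOn g (Icc 0 1)) (hh : ContinuousOn h (Icc 0 1)) :
    (∫ x in (0:ℝ)..1, g x * h x * v x) ≤
      √(∫ x in (0:ℝ)..1, g x ^ 2 * v x) * √(∫ x in (0:ℝ)..1, h x ^ 2 * v x) := by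
  have i1 : IntervalIntegrable (fun x => g x ^ 2 * v x) volume 0 1 :=
    ContinuousOn.intervalIntegrable_of_Icc zero_le_one ((hg.pow 2).mul hv)
  have i2 : IntervalIntegrable (fun x => h x ^ 2 * v x) volume 0 1 :=
    ContinuousOn.intervalIntegrable_of_Icc zero_le_one ((hh.pow 2).mul hv)
  have i3 : IntervalIntegrable (fun x => g x * h x * v x) volume 0 1 :=
    ContinuousOn.intervalIntegrable_of_Icc zero_le_one ((hg.mul hh).mul hv)
  have p1 : 0 ≤ ∫ x in (0:ℝ)..1, g x ^ 2 * v x :=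
    intervalIntegral.integral_nonneg zero_le_one (fun x hx => mul_nonneg (sq_nonneg _) (hv0 x hx))
  have key : ∀ t : ℝ, 0 ≤ (∫ x in (0:ℝ)..1, g x ^ 2 * v x) * (t * t)
      + (-2 * ∫ x in (0:ℝ)..1, g x * h x * v x) * t + ∫ x in (0:ℝ)..1, h x ^ 2 * v x := by
    intro t
    have e : ∫ x in (0:ℝ)..1, (t * g x - h x) ^ 2 * v x =
        (∫ x in (0:ℝ)..1, g x ^ 2 * v x) * (t * t)
      + (-2 * ∫ x in (0:ℝ)..1, g x * h x * v x) * t + ∫ x in (0:ℝ)..1, h x ^ 2 * v x := by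
      have : (fun x => (t * g x - h x) ^ 2 * v x) = fun x =>
          (t * t) * (g x ^ 2 * v x) + (-2 * t) * (g x * h x * v x) + h x ^ 2 * v x := by
        funext x; ring
      rw [this, intervalIntegral.integral_add ((i1.const_mul _).add (i3.const_mul _)) i2,
        intervalIntegral.integral_add (i1.const_mul _) (i3.const_mul _),
        intervalIntegral.integral_const_mul, intervalIntegral.integral_const_mul]
      ring
    rw [← e]
    exact intervalIntegral.integral_nonneg zero_le_one
      (fun x hx => mul_nonneg (sq_nonneg _) (hv0 x hx))
  have d := discrim_le_zero key
  rw [← Real.sqrt_mul p1]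
  apply Real.le_sqrt_of_sq_le
  unfold discrim at d
  nlinarith

/-- discrete log convexity, endpoint step -/
lemma pti_disc0 (A : ℕ → ℝ) (hA : ∀ i, 0 ≤ A i) (h : ∀ i, A (i+1) ^ 2 ≤ A i * A (i+2)) (k : ℕ) :
    A k ^ (k+1) ≤ A 0 * A (k+1) ^ k := by
  induction k with
  | zero => simp
  | succ k ih =>
    rcases (hA (k+1)).eq_or_lt with h0 | h0
    · rw [← h0, zero_pow (by omega)]
      exact mul_nonneg (hA _) (pow_nonneg (hA _) _)
    · have h1 : (A (k+1) ^ 2) ^ (k+1) ≤ (A k * A (k+2)) ^ (k+1) :=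
        pow_le_pow_left₀ (sq_nonneg _) (h k) _
      rw [mul_pow] at h1
      have h2 : A k ^ (k+1) * A (k+2) ^ (k+1) ≤ (A 0 * A (k+1) ^ k) * A (k+2) ^ (k+1) :=
        mul_le_mul_of_nonneg_right ih (pow_nonneg (hA _) _)
      have h3 : A (k+1) ^ k * A (k+1) ^ (k+1+1) ≤ A (k+1) ^ k * (A 0 * A (k+1+1) ^ (k+1)) := by
        calc _ = (A (k+1) ^ 2) ^ (k+1) := by ring
          _ ≤ _ := h1.trans h2
          _ = _ := by ring
      exact le_of_mul_le_mul_left h3 (pow_pos h0 k)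

lemma pti_disc1 (A : ℕ → ℝ) (hA : ∀ i, 0 ≤ A i) (h : ∀ i, A (i+1) ^ 2 ≤ A i * A (i+2)) (i k : ℕ)
    (hk : 1 ≤ k) (hik : i ≤ k) :
    A i ≤ A 0 ^ (1 - (i:ℝ)/k) * A k ^ ((i:ℝ)/k) := by
  rcases Nat.eq_zero_or_pos i with rfl | hi
  · simp
  induction k, hik using Nat.le_induction with
  | base =>
    have : (i:ℝ) ≠ 0 := by positivity
    simp [this]
  | succ k hik ih =>
    have ih := ih (by omega)
    have hk0 : (0:ℝ) < k := by exact_mod_cast (by omega : 0 < k)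
    have hir : (i:ℝ) ≤ k := by exact_mod_cast hik
    have s1 : A k ≤ A 0 ^ (1/((k:ℝ)+1)) * A (k+1) ^ ((k:ℝ)/(k+1)) := by
      have h1 := Real.rpow_le_rpow (pow_nonneg (hA _) _) (pti_disc0 A hA h k)
        (by positivity : (0:ℝ) ≤ 1/((k:ℝ)+1))
      rw [Real.mul_rpow (hA _) (pow_nonneg (hA _) _), ← Real.rpow_natCast, ← Real.rpow_natCast,
        ← Real.rpow_mul (hA _), ← Real.rpow_mul (hA _)] at h1
      have e1 : ((k+1:ℕ):ℝ) * (1/((k:ℝ)+1)) = 1 := by push_cast; field_simp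
      have e2 : (k:ℝ) * (1/((k:ℝ)+1)) = (k:ℝ)/(k+1) := by ring
      rwa [e1, e2, Real.rpow_one] at h1
    have hle : (i:ℝ)/k ≤ 1 := by rw [div_le_one hk0]; exact hir
    refine ih.trans ?_
    calc A 0 ^ (1 - (i:ℝ)/k) * A k ^ ((i:ℝ)/k)
        ≤ A 0 ^ (1 - (i:ℝ)/k) * (A 0 ^ (1/((k:ℝ)+1)) * A (k+1) ^ ((k:ℝ)/(k+1))) ^ ((i:ℝ)/k) := by
          apply mul_le_mul_of_nonneg_left _ (Real.rpow_nonneg (hA _) _)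
          exact Real.rpow_le_rpow (hA _) s1 (by positivity)
      _ = (A 0 ^ (1 - (i:ℝ)/k) * A 0 ^ (1/((k:ℝ)+1) * ((i:ℝ)/k))) *
            A (k+1) ^ ((k:ℝ)/(k+1) * ((i:ℝ)/k)) := by
          rw [Real.mul_rpow (Real.rpow_nonneg (hA _) _) (Real.rpow_nonneg (hA _) _),
            ← Real.rpow_mul (hA _), ← Real.rpow_mul (hA _), mul_assoc]
      _ = _ := by
          rw [← Real.rpow_add_of_nonneg (hA _) (by linarith) (by positivity)]
          congr 2
          · push_cast; field_simp; ring
          · push_cast; field_simp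

lemma pti_disc2 (T : ℕ → ℝ) (D : ℝ) (hD : 1 ≤ D) (hT : ∀ i, 0 ≤ T i)
    (h : ∀ i, T (i+1) ^ 2 ≤ D * (T i * T (i+2))) (i k : ℕ)
    (hk : 1 ≤ k) (hik : i ≤ k) :
    T i ≤ D ^ (k^2) * (T 0 ^ (1 - (i:ℝ)/k) * T k ^ ((i:ℝ)/k)) := by
  have hD0 : 0 ≤ D := by linarith
  have key := pti_disc1 (fun i => D ^ (i^2) * T i) (fun i => mul_nonneg (pow_nonneg hD0 _) (hT i))
    (by
      intro i
      calc (D ^ ((i+1)^2) * T (i+1)) ^ 2 = D ^ (2 * i^2+4*i+2) * T (i+1) ^ 2 := by ring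
        _ ≤ D ^ (2 * i^2+4*i+2) * (D * (T i * T (i+2))) :=
          mul_le_mul_of_nonneg_left (h i) (pow_nonneg hD0 _)
        _ = D ^ (2 * i^2+4*i+3) * (T i * T (i+2)) := by ring
        _ ≤ D ^ (2 * i^2+4*i+4) * (T i * T (i+2)) :=
          mul_le_mul_of_nonneg_right (pow_le_pow_right₀ hD (by omega))
            (mul_nonneg (hT _) (hT _))
        _ = _ := by ring) i k hk hik
  have hk0 : (0:ℝ) < k := by exact_mod_cast (by omega : 0 < k)
  have hir : (i:ℝ) ≤ k := by exact_mod_cast hik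
  have hle : (i:ℝ)/k ≤ 1 := by rw [div_le_one hk0]; exact hir
  calc T i ≤ D ^ (i^2) * T i := le_mul_of_one_le_left (hT i) (one_le_pow₀ hD)
    _ ≤ _ := key
    _ = (D ^ (k^2)) ^ ((i:ℝ)/k) * (T 0 ^ (1 - (i:ℝ)/k) * T k ^ ((i:ℝ)/k)) := by
      rw [Real.mul_rpow (pow_nonneg hD0 (k^2)) (hT k), zero_pow two_ne_zero, pow_zero, one_mul]; ring
    _ ≤ _ := by
      apply mul_le_mul_of_nonneg_right _
        (mul_nonneg (Real.rpow_nonneg (hT _) _) (Real.rpow_nonneg (hT _) _))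
      calc (D ^ (k^2)) ^ ((i:ℝ)/k) ≤ (D ^ (k^2)) ^ (1:ℝ) :=
            Real.rpow_le_rpow_of_exponent_le (one_le_pow₀ hD) hle
        _ = _ := Real.rpow_one _

/-- abstract chain of functions -/
structure PtiChain {E : Type*} [NormedAddCommGroup E] [InnerProductSpace ℝ E]
    (Ψ : ℕ → ℝ → E) (v : ℝ → ℝ) : Prop where
  hv : ContinuousOn v (Icc 0 1)
  hv0 : ∀ x ∈ Icc (0:ℝ) 1, 0 ≤ v x
  hint : ∫ x in (0:ℝ)..1, v x = 1
  hc : ∀ i, ContinuousOn (Ψ i) (Icc 0 1)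
  hd : ∀ i j, ∀ x ∈ Icc (0:ℝ) 1, HasDerivAt (fun x => ⟪Ψ i x, Ψ j x⟫)
    ((⟪Ψ (i+1) x, Ψ j x⟫ + ⟪Ψ i x, Ψ (j+1) x⟫) * v x) x

def ptiN {E : Type*} [NormedAddCommGroup E] [InnerProductSpace ℝ E]
    (Ψ : ℕ → ℝ → E) (v : ℝ → ℝ) (i : ℕ) : ℝ := √(∫ x in (0:ℝ)..1, ‖Ψ i x‖ ^ 2 * v x)

section chain
variable {E : Type*} [NormedAddCommGroup E] [InnerProductSpace ℝ E]
    {Ψ : ℕ → ℝ → E} {v : ℝ → ℝ}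

lemma PtiChain.cs (H : PtiChain Ψ v) (i j : ℕ) :
    (∫ x in (0:ℝ)..1, ‖Ψ i x‖ * ‖Ψ j x‖ * v x) ≤ ptiN Ψ v i * ptiN Ψ v j :=
  pti_cs v _ _ H.hv H.hv0 (H.hc i).norm (H.hc j).norm

lemma PtiChain.ftc (H : PtiChain Ψ v) (i j : ℕ) {x y : ℝ} (hx : x ∈ Icc (0:ℝ) 1)
    (hy : y ∈ Icc (0:ℝ) 1) :
    ⟪Ψ i x, Ψ j x⟫ - ⟪Ψ i y, Ψ j y⟫ =
      ∫ z in y..x, (⟪Ψ (i+1) z, Ψ j z⟫ + ⟪Ψ i z, Ψ (j+1) z⟫) * v z := by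
  have hs : uIcc y x ⊆ Icc 0 1 := uIcc_subset_Icc hy hx
  rw [intervalIntegral.integral_eq_sub_of_hasDerivAt (fun z hz => H.hd i j z (hs hz))]
  apply ContinuousOn.intervalIntegrable
  exact ((((H.hc _).inner (𝕜 := ℝ) (H.hc _)).add ((H.hc _).inner (𝕜 := ℝ) (H.hc _))).mul H.hv).mono hs

lemma ptiN_nonneg (i : ℕ) : 0 ≤ ptiN Ψ v i := Real.sqrt_nonneg _

lemma PtiChain.sqN (H : PtiChain Ψ v) (i : ℕ) :
    ptiN Ψ v i ^ 2 = ∫ x in (0:ℝ)..1, ‖Ψ i x‖ ^ 2 * v x :=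
  Real.sq_sqrt (intervalIntegral.integral_nonneg zero_le_one
      (fun x hx => mul_nonneg (sq_nonneg _) (H.hv0 x hx)))

lemma PtiChain.sup (H : PtiChain Ψ v) (i : ℕ) {x : ℝ} (hx : x ∈ Icc (0:ℝ) 1) :
    ‖Ψ i x‖ ^ 2 ≤ ptiN Ψ v i ^ 2 + 2 * (ptiN Ψ v i * ptiN Ψ v (i+1)) := by
  set B := 2 * (ptiN Ψ v i * ptiN Ψ v (i+1)) with hB
  have hcI : ContinuousOn (fun z => 2 * (‖Ψ i z‖ * ‖Ψ (i+1) z‖ * v z)) (Icc 0 1) :=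
    continuousOn_const.mul ((((H.hc i).norm).mul (H.hc (i+1)).norm).mul H.hv)
  have hdiff : ∀ y ∈ Icc (0:ℝ) 1, ‖Ψ i x‖ ^ 2 - B ≤ ‖Ψ i y‖ ^ 2 := by
    intro y hy
    have h1 := H.ftc i i hx hy
    rw [real_inner_self_eq_norm_sq, real_inner_self_eq_norm_sq] at h1
    have h2 : |∫ z in y..x, (⟪Ψ (i+1) z, Ψ i z⟫ + ⟪Ψ i z, Ψ (i+1) z⟫) * v z| ≤ B := by
      have hs : uIoc y x ⊆ Ioc 0 1 := by
        intro z hz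
        rw [mem_uIoc] at hz
        rcases hz with hz | hz
        · exact ⟨lt_of_le_of_lt hy.1 hz.1, hz.2.trans hx.2⟩
        · exact ⟨lt_of_le_of_lt hx.1 hz.1, hz.2.trans hy.2⟩
      have hint1 : IntegrableOn (fun z => 2 * (‖Ψ i z‖ * ‖Ψ (i+1) z‖ * v z)) (Ioc 0 1) volume :=
        (hcI.integrableOn_compact isCompact_Icc).mono_set Ioc_subset_Icc_self
      calc _ ≤ ∫ z in uIoc y x, ‖(⟪Ψ (i+1) z, Ψ i z⟫ + ⟪Ψ i z, Ψ (i+1) z⟫) * v z‖ := by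
            rw [← Real.norm_eq_abs]
            exact intervalIntegral.norm_integral_le_integral_norm_uIoc
        _ ≤ ∫ z in uIoc y x, 2 * (‖Ψ i z‖ * ‖Ψ (i+1) z‖ * v z) := by
            apply setIntegral_mono_on _ (hint1.mono_set hs) measurableSet_uIoc
            · intro z hz
              have hz' := Ioc_subset_Icc_self (hs hz)
              rw [norm_mul, Real.norm_eq_abs, Real.norm_eq_abs, abs_of_nonneg (H.hv0 z hz'),
                real_inner_comm, ← two_mul, abs_mul, abs_two, mul_assoc]
              have := abs_real_inner_le_norm (Ψ i z) (Ψ (i+1) z)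
              have := H.hv0 z hz'
              gcongr
            · have hcc : ContinuousOn (fun z => ‖(⟪Ψ (i+1) z, Ψ i z⟫ + ⟪Ψ i z, Ψ (i+1) z⟫) * v z‖) (Icc 0 1) :=
                ((((H.hc _).inner (𝕜 := ℝ) (H.hc _)).add ((H.hc _).inner (𝕜 := ℝ) (H.hc _))).mul H.hv).norm
              exact (hcc.integrableOn_compact isCompact_Icc).mono_set
                (hs.trans Ioc_subset_Icc_self)
        _ ≤ ∫ z in Ioc (0:ℝ) 1, 2 * (‖Ψ i z‖ * ‖Ψ (i+1) z‖ * v z) := by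
            apply setIntegral_mono_set hint1 _ (LE.le.eventuallyLE hs)
            apply (ae_restrict_iff' measurableSet_Ioc).2
            filter_upwards with z hz
            have := H.hv0 z (Ioc_subset_Icc_self hz)
            simp only [Pi.zero_apply]; positivity
        _ = 2 * ∫ z in (0:ℝ)..1, ‖Ψ i z‖ * ‖Ψ (i+1) z‖ * v z := by
            rw [← intervalIntegral.integral_of_le zero_le_one, intervalIntegral.integral_const_mul]
        _ ≤ B := by rw [hB]; linarith [H.cs i (i+1)]
    have := abs_le.1 h2
    linarith
  have h3 : ∫ y in (0:ℝ)..1, (‖Ψ i x‖ ^ 2 - B) * v y ≤ ∫ y in (0:ℝ)..1, ‖Ψ i y‖ ^ 2 * v y := by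
    apply intervalIntegral.integral_mono_on zero_le_one
    · exact ContinuousOn.intervalIntegrable_of_Icc zero_le_one (continuousOn_const.mul H.hv)
    · exact ContinuousOn.intervalIntegrable_of_Icc zero_le_one (((H.hc i).norm.pow 2).mul H.hv)
    · intro y hy
      exact mul_le_mul_of_nonneg_right (hdiff y hy) (H.hv0 y hy)
  rw [intervalIntegral.integral_const_mul, H.hint, mul_one, ← H.sqN] at h3
  linarith

lemma PtiChain.ibp (H : PtiChain Ψ v) (i : ℕ) :
    ptiN Ψ v (i+1) ^ 2 ≤ 128 * (ptiN Ψ v i * (ptiN Ψ v i + ptiN Ψ v (i+1) + ptiN Ψ v (i+2))) := by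
  have h1 := H.ftc i (i+1) (right_mem_Icc.2 zero_le_one) (left_mem_Icc.2 zero_le_one)
  have i1 : IntervalIntegrable (fun z => ‖Ψ (i+1) z‖ ^ 2 * v z) volume 0 1 :=
    ContinuousOn.intervalIntegrable_of_Icc zero_le_one (((H.hc _).norm.pow 2).mul H.hv)
  have i2 : IntervalIntegrable (fun z => ⟪Ψ i z, Ψ (i+2) z⟫ * v z) volume 0 1 :=
    ContinuousOn.intervalIntegrable_of_Icc zero_le_one
      (((H.hc _).inner (𝕜 := ℝ) (H.hc _)).mul H.hv)
  have e : ∫ z in (0:ℝ)..1, (⟪Ψ (i+1) z, Ψ (i+1) z⟫ + ⟪Ψ i z, Ψ (i+1+1) z⟫) * v z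
      = ptiN Ψ v (i+1) ^ 2 + ∫ z in (0:ℝ)..1, ⟪Ψ i z, Ψ (i+2) z⟫ * v z := by
    rw [H.sqN, ← intervalIntegral.integral_add i1 i2]
    congr 1; funext z; rw [real_inner_self_eq_norm_sq]; ring
  rw [e] at h1
  have h2 : -(∫ z in (0:ℝ)..1, ⟪Ψ i z, Ψ (i+2) z⟫ * v z) ≤ ptiN Ψ v i * ptiN Ψ v (i+2) := by
    rw [← intervalIntegral.integral_neg]
    refine le_trans ?_ (H.cs i (i+2))
    apply intervalIntegral.integral_mono_on zero_le_one i2.neg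
    · exact ContinuousOn.intervalIntegrable_of_Icc zero_le_one
        (((H.hc _).norm.mul (H.hc _).norm).mul H.hv)
    · intro z hz
      have := (abs_le.1 (abs_real_inner_le_norm (Ψ i z) (Ψ (i+2) z))).1
      have := H.hv0 z hz
      simp only [Pi.neg_apply]
      nlinarith
  set p := ptiN Ψ v i
  set q := ptiN Ψ v (i+1)
  set r := ptiN Ψ v (i+2)
  have hp : 0 ≤ p := ptiN_nonneg _
  have hq : 0 ≤ q := ptiN_nonneg _
  have hr : 0 ≤ r := ptiN_nonneg _
  rcases le_total q p with hqp | hqp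
  · nlinarith [mul_nonneg hp hr, mul_nonneg hp hp, mul_nonneg hp hq]
  -- boundary terms
  have hb : ∀ x ∈ Icc (0:ℝ) 1, |⟪Ψ i x, Ψ (i+1) x⟫| ≤ q ^ 2 / 8 + 18 * (p * (q + r)) := by
    intro x hx
    have s0 : ‖Ψ i x‖ ^ 2 ≤ 3 * (p * q) := by
      have : ‖Ψ i x‖ ^ 2 ≤ p ^ 2 + 2 * (p * q) := H.sup i hx
      nlinarith
    have s1 : ‖Ψ (i+1) x‖ ^ 2 ≤ 2 * (q * (q + r)) := by
      have : ‖Ψ (i+1) x‖ ^ 2 ≤ q ^ 2 + 2 * (q * r) := H.sup (i+1) hx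
      nlinarith
    refine (abs_real_inner_le_norm _ _).trans ?_
    apply abs_le_of_sq_le_sq' _ (by positivity) |>.2
    calc (‖Ψ i x‖ * ‖Ψ (i+1) x‖) ^ 2 = ‖Ψ i x‖ ^ 2 * ‖Ψ (i+1) x‖ ^ 2 := by ring
      _ ≤ (3 * (p * q)) * (2 * (q * (q + r))) := by gcongr
      _ = 6 * (q ^ 2 * (p * (q + r))) := by ring
      _ ≤ _ := by
        have : 0 ≤ p * (q + r) := by positivity
        nlinarith [sq_nonneg (q ^ 2 / 8 - 18 * (p * (q + r))), mul_nonneg (sq_nonneg q) this]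
  have b0 := abs_le.1 (hb 0 (left_mem_Icc.2 zero_le_one))
  have b1 := abs_le.1 (hb 1 (right_mem_Icc.2 zero_le_one))
  nlinarith [mul_nonneg hp hr, mul_nonneg hp hp, mul_nonneg hp hq]

def ptiT (Ψ : ℕ → ℝ → E) (v : ℝ → ℝ) (k : ℕ) : ℝ := ∑ i ∈ Finset.range (k+1), ptiN Ψ v i

lemma ptiT_nonneg (k : ℕ) : 0 ≤ ptiT Ψ v k := Finset.sum_nonneg (fun i _ => ptiN_nonneg i)

lemma ptiN_le_T (k : ℕ) : ptiN Ψ v k ≤ ptiT Ψ v k :=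
  Finset.single_le_sum (f := ptiN Ψ v) (fun i _ => ptiN_nonneg i) (Finset.self_mem_range_succ k)

lemma ptiT_succ (k : ℕ) : ptiT Ψ v (k+1) = ptiT Ψ v k + ptiN Ψ v (k+1) :=
  Finset.sum_range_succ _ _

lemma PtiChain.T_conv (H : PtiChain Ψ v) (i : ℕ) :
    ptiT Ψ v (i+1) ^ 2 ≤ 1000 * (ptiT Ψ v i * ptiT Ψ v (i+2)) := by
  have h := H.ibp i
  have a1 := ptiT_succ (Ψ := Ψ) (v := v) i
  have a2 := ptiT_succ (Ψ := Ψ) (v := v) (i+1)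
  have a3 := ptiN_le_T (Ψ := Ψ) (v := v) i
  have n0 := ptiN_nonneg (Ψ := Ψ) (v := v) i
  have n1 := ptiN_nonneg (Ψ := Ψ) (v := v) (i+1)
  have n2 := ptiN_nonneg (Ψ := Ψ) (v := v) (i+2)
  have t0 := ptiT_nonneg (Ψ := Ψ) (v := v) i
  have hle : ptiN Ψ v i * (ptiN Ψ v i + ptiN Ψ v (i+1) + ptiN Ψ v (i+2)) ≤
      ptiT Ψ v i * ptiT Ψ v (i+2) := by
    apply mul_le_mul a3 _ (by positivity) t0
    rw [show i + 2 = i + 1 + 1 from rfl, a2, a1]; linarith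
  have hsq : ptiT Ψ v i ^ 2 ≤ ptiT Ψ v i * ptiT Ψ v (i+2) := by
    rw [sq]
    apply mul_le_mul_of_nonneg_left _ t0
    rw [show i + 2 = i + 1 + 1 from rfl, a2, a1]; linarith
  rw [a1]
  nlinarith [sq_nonneg (ptiT Ψ v i - ptiN Ψ v (i+1))]

lemma PtiChain.interp2 (H : PtiChain Ψ v) (i k : ℕ) (hk : 1 ≤ k) (hik : i ≤ k) :
    ptiT Ψ v i ≤ 1000 ^ (k^2) * (ptiT Ψ v 0 ^ (1 - (i:ℝ)/k) * ptiT Ψ v k ^ ((i:ℝ)/k)) :=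
  pti_disc2 (ptiT Ψ v) 1000 (by norm_num) ptiT_nonneg H.T_conv i k hk hik

lemma PtiChain.interpInf (H : PtiChain Ψ v) (i k : ℕ) (hik : i < k) {x : ℝ}
    (hx : x ∈ Icc (0:ℝ) 1) :
    ‖Ψ i x‖ ≤ 2 * 1000 ^ (k^2) *
      (ptiT Ψ v 0 ^ (1 - ((i:ℝ) + 1/2)/k) * ptiT Ψ v k ^ (((i:ℝ)+1/2)/k)) := by
  have t0 := ptiT_nonneg (Ψ := Ψ) (v := v) 0
  have tk := ptiT_nonneg (Ψ := Ψ) (v := v) k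
  have hk0 : (0:ℝ) < k := by exact_mod_cast (by omega : 0 < k)
  have hir : (i:ℝ) + 1 ≤ k := by exact_mod_cast hik
  have hle : ((i:ℝ)+1)/k ≤ 1 := by rw [div_le_one hk0]; exact hir
  have hle' : ((i:ℝ))/k ≤ 1 := by rw [div_le_one hk0]; linarith
  have hle2 : ((i:ℝ)+1/2)/k ≤ 1 := by rw [div_le_one hk0]; linarith
  have A := H.interp2 i k (by omega) hik.le
  have B := H.interp2 (i+1) k (by omega) hik
  have S : ‖Ψ i x‖ ^ 2 ≤ 4 * (ptiT Ψ v i * ptiT Ψ v (i+1)) := by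
    have h := H.sup i hx
    have a1 := ptiT_succ (Ψ := Ψ) (v := v) i
    have a3 := ptiN_le_T (Ψ := Ψ) (v := v) i
    have n0 := ptiN_nonneg (Ψ := Ψ) (v := v) i
    have n1 := ptiN_nonneg (Ψ := Ψ) (v := v) (i+1)
    have : ptiN Ψ v i * (ptiN Ψ v i + ptiN Ψ v (i+1)) ≤ ptiT Ψ v i * ptiT Ψ v (i+1) := by
      apply mul_le_mul a3 (by linarith) (by positivity) (ptiT_nonneg _)
    nlinarith [mul_nonneg n0 n1, mul_nonneg n0 n0]
  apply abs_le_of_sq_le_sq' _ (by positivity) |>.2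
  refine S.trans ?_
  have M := mul_le_mul A B (ptiT_nonneg _) (by positivity)
  calc _ ≤ 4 * _ := mul_le_mul_of_nonneg_left M (by norm_num)
    _ = 4 * (1000 ^ (k^2)) ^ 2 * ((ptiT Ψ v 0 ^ (1 - (i:ℝ)/k) * ptiT Ψ v 0 ^ (1 - ((i+1:ℕ):ℝ)/k)) *
        (ptiT Ψ v k ^ ((i:ℝ)/k) * ptiT Ψ v k ^ (((i+1:ℕ):ℝ)/k))) := by ring
    _ = 4 * (1000 ^ (k^2)) ^ 2 * ((ptiT Ψ v 0 ^ (1 - ((i:ℝ) + 1/2)/k) * ptiT Ψ v 0 ^ (1 - ((i:ℝ) + 1/2)/k)) *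
        (ptiT Ψ v k ^ (((i:ℝ)+1/2)/k) * ptiT Ψ v k ^ (((i:ℝ)+1/2)/k))) := by
      push_cast
      rw [← Real.rpow_add_of_nonneg t0 (by linarith) (by linarith),
        ← Real.rpow_add_of_nonneg t0 (by linarith) (by linarith),
        ← Real.rpow_add_of_nonneg tk (by positivity) (by positivity),
        ← Real.rpow_add_of_nonneg tk (by positivity) (by positivity)]
      rw [show 1 - (i:ℝ)/k + (1 - ((i:ℝ)+1)/k) = 1 - ((i:ℝ) + 1/2)/k + (1 - ((i:ℝ) + 1/2)/k) by ring,
        show (i:ℝ)/k + ((i:ℝ)+1)/k = ((i:ℝ) + 1/2)/k + ((i:ℝ) + 1/2)/k by ring]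
    _ = _ := by ring

lemma PtiChain.main (H : PtiChain Ψ v) (k a b : ℕ) (hk : 1 ≤ k) (hb : 2 ≤ b) (ha : a < 2 * k)
    (i : Fin b → ℕ) (hi : ∑ j, i j = a) (hik : ∀ j, i j ≤ k) :
    (∫ x in (0:ℝ)..1, (∏ j, ‖Ψ (i j) x‖) * v x) ≤ (2 * 1000 ^ (k^2)) ^ b *
      ptiT Ψ v 0 ^ ((b:ℝ) - ((a:ℝ) + (b:ℝ)/2 - 1)/k) *
      ptiT Ψ v k ^ (((a:ℝ) + (b:ℝ)/2 - 1)/k) := by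
  have : Nonempty (Fin b) := ⟨⟨0, by omega⟩⟩
  have t0 := ptiT_nonneg (Ψ := Ψ) (v := v) 0
  have tk := ptiT_nonneg (Ψ := Ψ) (v := v) k
  have hk0 : (0:ℝ) < k := by exact_mod_cast (by omega : 0 < k)
  obtain ⟨j0, hj0⟩ := Finite.exists_max i
  have : Nontrivial (Fin b) := Fin.nontrivial_iff_two_le.2 hb
  obtain ⟨j1, hj1⟩ := exists_ne j0
  have hlt : ∀ j, j ≠ j0 → i j < k := by
    intro j hj
    have h1 : i j + i j0 ≤ a := by
      rw [← hi, ← Finset.sum_pair hj]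
      exact Finset.sum_le_sum_of_subset (Finset.subset_univ _)
    have := hj0 j
    omega
  set R : Finset (Fin b) := (Finset.univ.erase j0).erase j1 with hR
  have m1 : j1 ∈ Finset.univ.erase j0 := by simp [hj1]
  have hprod : ∀ g : Fin b → ℝ, ∏ j, g j = g j0 * g j1 * ∏ j ∈ R, g j := by
    intro g
    rw [← Finset.mul_prod_erase Finset.univ g (Finset.mem_univ j0),
      ← Finset.mul_prod_erase _ g m1, mul_assoc]
  have hsum : ∀ g : Fin b → ℝ, ∑ j, g j = g j0 + g j1 + ∑ j ∈ R, g j := by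
    intro g
    rw [← Finset.add_sum_erase Finset.univ g (Finset.mem_univ j0),
      ← Finset.add_sum_erase _ g m1, add_assoc]
  have hRc : (R.card : ℝ) = b - 2 := by
    have := hsum (fun _ => 1)
    simp at this
    linarith
  set K : ℝ := 2 * 1000 ^ (k^2) with hK
  set e : Fin b → ℝ := fun j => if j ∈ R then ((i j : ℝ) + 1/2)/k else (i j : ℝ)/k with he
  have nR0 : j0 ∉ R := by simp [hR]
  have nR1 : j1 ∉ R := by simp [hR]
  have he0 : ∀ j, 0 ≤ e j := by
    intro j; simp only [he]; split_ifs <;> positivity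
  have he1 : ∀ j, e j ≤ 1 := by
    intro j; simp only [he]; split_ifs with h
    · rw [div_le_one hk0]
      have : j ≠ j0 := by rintro rfl; exact nR0 h
      have : (i j : ℝ) + 1 ≤ k := by exact_mod_cast hlt j this
      linarith
    · rw [div_le_one hk0]; exact_mod_cast hik j
  have hesum : ∑ j, e j = ((a:ℝ) + (b:ℝ)/2 - 1)/k := by
    have h1 : ∑ j ∈ R, e j = ∑ j ∈ R, (((i j : ℝ))/k + 1/2/k) := by
      apply Finset.sum_congr rfl
      intro j hj
      simp only [he, if_pos hj]; ring
    have h2 : ((a:ℝ))/k = ∑ j, (i j : ℝ)/k := by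
      rw [← Finset.sum_div, ← hi]; push_cast; rfl
    rw [hsum e, h1, Finset.sum_add_distrib, Finset.sum_const, nsmul_eq_mul, hRc]
    rw [hsum] at h2
    have h3 : ((a:ℝ) + (b:ℝ)/2 - 1)/k = (a:ℝ)/k + ((b:ℝ) - 2) * (1/2/k) := by ring
    rw [h3, h2]; simp only [he, if_neg nR0, if_neg nR1]; ring
  set Q : Fin b → ℝ := fun j => K * (ptiT Ψ v 0 ^ (1 - e j) * ptiT Ψ v k ^ (e j)) with hQ
  have hQ0 : ∀ j, 0 ≤ Q j := fun j => by simp only [hQ]; positivity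
  have hQN : ∀ j, j ∉ R → ptiN Ψ v (i j) ≤ Q j := by
    intro j hj
    refine (ptiN_le_T _).trans ((H.interp2 (i j) k hk (hik j)).trans ?_)
    simp only [hQ, he, if_neg hj]
    apply mul_le_mul_of_nonneg_right _ (by positivity)
    rw [hK]
    linarith [show (0:ℝ) ≤ 1000 ^ (k^2) by positivity]
  have hQs : ∀ j ∈ R, ∀ x ∈ Icc (0:ℝ) 1, ‖Ψ (i j) x‖ ≤ Q j := by
    intro j hj x hx
    have : j ≠ j0 := by rintro rfl; exact nR0 hj
    simp only [hQ, he, if_pos hj]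
    exact H.interpInf (i j) k (hlt j this) hx
  have P0 : 0 ≤ ∏ j ∈ R, Q j := Finset.prod_nonneg (fun j _ => hQ0 j)
  calc (∫ x in (0:ℝ)..1, (∏ j, ‖Ψ (i j) x‖) * v x)
      ≤ ∫ x in (0:ℝ)..1, (∏ j ∈ R, Q j) * (‖Ψ (i j0) x‖ * ‖Ψ (i j1) x‖ * v x) := by
        apply intervalIntegral.integral_mono_on zero_le_one
        · exact ContinuousOn.intervalIntegrable_of_Icc zero_le_one
            ((continuousOn_finsetProd _ (fun j _ => (H.hc _).norm)).mul H.hv)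
        · exact ContinuousOn.intervalIntegrable_of_Icc zero_le_one
            (continuousOn_const.mul (((H.hc _).norm.mul (H.hc _).norm).mul H.hv))
        · intro x hx
          rw [hprod]
          have h1 : ∏ j ∈ R, ‖Ψ (i j) x‖ ≤ ∏ j ∈ R, Q j :=
            Finset.prod_le_prod (fun j _ => norm_nonneg _) (fun j hj => hQs j hj x hx)
          have h2 : 0 ≤ ‖Ψ (i j0) x‖ * ‖Ψ (i j1) x‖ * v x :=
            mul_nonneg (by positivity) (H.hv0 x hx)
          calc _ = (∏ j ∈ R, ‖Ψ (i j) x‖) * (‖Ψ (i j0) x‖ * ‖Ψ (i j1) x‖ * v x) := by ring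
            _ ≤ _ := mul_le_mul_of_nonneg_right h1 h2
    _ ≤ (∏ j ∈ R, Q j) * (ptiN Ψ v (i j0) * ptiN Ψ v (i j1)) := by
        rw [intervalIntegral.integral_const_mul]
        exact mul_le_mul_of_nonneg_left (H.cs _ _) P0
    _ ≤ (∏ j ∈ R, Q j) * (Q j0 * Q j1) :=
        mul_le_mul_of_nonneg_left
          (mul_le_mul (hQN _ nR0) (hQN _ nR1) (ptiN_nonneg _) (hQ0 _)) P0
    _ = ∏ j, Q j := by rw [hprod]; ring
    _ = _ := by
        simp only [hQ]
        clear_value K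
        rw [Finset.prod_mul_distrib, Finset.prod_mul_distrib,
          ← Real.rpow_sum_of_nonneg t0 (fun j _ => by linarith [he1 j]),
          ← Real.rpow_sum_of_nonneg tk (fun j _ => he0 j), Finset.sum_sub_distrib, hesum]
        simp [mul_assoc]

end chain
section geom
variable {n : ℕ} {f : ℝ → EuclideanSpace ℝ (Fin n)}

lemma pti_isOpen (hf : ContDiff ℝ (⊤ : ℕ∞) f) : IsOpen {x | deriv f x ≠ 0} :=
  isOpen_ne_fun (hf.continuous_deriv (by exact_mod_cast le_top)) continuous_const

lemma pti_smooth_sDeriv (hf : ContDiff ℝ (⊤ : ℕ∞) f) {F : Type*} [NormedAddCommGroup F]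
    [NormedSpace ℝ F] {g : ℝ → F}
    (hg : ContDiffOn ℝ (⊤ : ℕ∞) g {x | deriv f x ≠ 0}) :
    ContDiffOn ℝ (⊤ : ℕ∞) (sDeriv f g) {x | deriv f x ≠ 0} := by
  have h1 : ContDiffOn ℝ (⊤ : ℕ∞) (deriv g) {x | deriv f x ≠ 0} :=
    hg.deriv_of_isOpen (pti_isOpen hf) (by exact_mod_cast le_top)
  have h2 : ContDiffOn ℝ (⊤ : ℕ∞) (deriv f) {x | deriv f x ≠ 0} :=
    hf.contDiffOn.deriv_of_isOpen (pti_isOpen hf) (by exact_mod_cast le_top)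
  have h3 : ContDiffOn ℝ (⊤ : ℕ∞) (fun x => ‖deriv f x‖) {x | deriv f x ≠ 0} :=
    h2.norm ℝ (fun x hx => hx)
  exact (h3.inv (fun x hx => norm_ne_zero_iff.2 hx)).smul h1

lemma pti_smooth_tau (hf : ContDiff ℝ (⊤ : ℕ∞) f) :
    ContDiffOn ℝ (⊤ : ℕ∞) (tau f) {x | deriv f x ≠ 0} :=
  pti_smooth_sDeriv hf hf.contDiffOn

lemma pti_smooth_iter (hf : ContDiff ℝ (⊤ : ℕ∞) f) (i : ℕ) :
    ContDiffOn ℝ (⊤ : ℕ∞) (nablaSIter f i (kappa f)) {x | deriv f x ≠ 0} := by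
  induction i with
  | zero => exact pti_smooth_sDeriv hf (pti_smooth_tau hf)
  | succ i ih =>
    have h := pti_smooth_sDeriv hf ih
    exact h.sub ((h.inner ℝ (pti_smooth_tau hf)).smul (pti_smooth_tau hf))

lemma pti_tau_unit {x : ℝ} (hx : deriv f x ≠ 0) : ⟪tau f x, tau f x⟫ = 1 := by
  rw [real_inner_self_eq_norm_sq]
  have : ‖deriv f x‖ ≠ 0 := norm_ne_zero_iff.2 hx
  simp [tau, sDeriv, norm_smul, this]

lemma pti_perp (hf : ContDiff ℝ (⊤ : ℕ∞) f) (i : ℕ) {x : ℝ} (hx : deriv f x ≠ 0) :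
    ⟪nablaSIter f i (kappa f) x, tau f x⟫ = 0 := by
  cases i with
  | zero =>
    have hd : DifferentiableAt ℝ (tau f) x :=
      ((pti_smooth_tau hf).differentiableOn (by simp)).differentiableAt
        ((pti_isOpen hf).mem_nhds hx)
    have h1 := hd.hasDerivAt.inner ℝ hd.hasDerivAt
    have h2 : (fun t => ⟪tau f t, tau f t⟫) =ᶠ[nhds x] fun _ => (1:ℝ) := by
      filter_upwards [(pti_isOpen hf).mem_nhds hx] with y hy using pti_tau_unit hy
    have h3 := h1.unique ((hasDerivAt_const x (1:ℝ)).congr_of_eventuallyEq h2)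
    rw [real_inner_comm, ← two_mul] at h3
    have h4 : ⟪deriv (tau f) x, tau f x⟫ = 0 := by linarith
    simp only [nablaSIter, kappa, sDeriv, real_inner_smul_left]
    rw [h4, mul_zero]
  | succ i =>
    simp only [nablaSIter, nablaS, inner_sub_left, real_inner_smul_left]
    rw [pti_tau_unit hx]; ring

lemma pti_inner_deriv (hf : ContDiff ℝ (⊤ : ℕ∞) f) (i j : ℕ) {x : ℝ} (hx : deriv f x ≠ 0) :
    HasDerivAt (fun x => ⟪nablaSIter f i (kappa f) x, nablaSIter f j (kappa f) x⟫)
      ((⟪nablaSIter f (i+1) (kappa f) x, nablaSIter f j (kappa f) x⟫ +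
        ⟪nablaSIter f i (kappa f) x, nablaSIter f (j+1) (kappa f) x⟫) * ‖deriv f x‖) x := by
  have hd : ∀ i, DifferentiableAt ℝ (nablaSIter f i (kappa f)) x := fun i =>
      ((pti_smooth_iter hf i).differentiableOn (by simp)).differentiableAt
        ((pti_isOpen hf).mem_nhds hx)
  have hw : ‖deriv f x‖ ≠ 0 := norm_ne_zero_iff.2 hx
  have e : ∀ i j, ⟪nablaSIter f (i+1) (kappa f) x, nablaSIter f j (kappa f) x⟫ * ‖deriv f x‖ =
      ⟪deriv (nablaSIter f i (kappa f)) x, nablaSIter f j (kappa f) x⟫ := by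
    intro i j
    have hp := pti_perp hf j hx
    rw [real_inner_comm] at hp
    simp only [nablaSIter, nablaS, inner_sub_left, real_inner_smul_left]
    rw [hp]
    simp only [sDeriv, real_inner_smul_left]
    field_simp
    ring
  have h1 := (hd i).hasDerivAt.inner ℝ (hd j).hasDerivAt
  refine h1.congr_deriv ?_
  have e2 := e j i
  rw [real_inner_comm, real_inner_comm _ (deriv _ x)] at e2
  rw [add_mul, e, e2, add_comm]

lemma pti_len_pos (hf : ContDiff ℝ (⊤ : ℕ∞) f) (h0 : ∀ x ∈ Icc (0 : ℝ) 1, deriv f x ≠ 0) :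
    0 < curveLen f := by
  apply intervalIntegral.intervalIntegral_pos_of_pos_on _ _ zero_lt_one
  · exact (hf.continuous_deriv (by exact_mod_cast le_top)).norm.intervalIntegrable _ _
  · intro x hx
    exact norm_pos_iff.2 (h0 x (Ioo_subset_Icc_self hx))

lemma pti_chain (hf : ContDiff ℝ (⊤ : ℕ∞) f) (h0 : ∀ x ∈ Icc (0 : ℝ) 1, deriv f x ≠ 0) :
    PtiChain (fun i x => curveLen f ^ (i+1) • nablaSIter f i (kappa f) x)
      (fun x => ‖deriv f x‖ / curveLen f) where
  hv := ((hf.continuous_deriv (by exact_mod_cast le_top)).norm.div_const _).continuousOn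
  hv0 := fun x _ => div_nonneg (norm_nonneg _) (pti_len_pos hf h0).le
  hint := by
    rw [intervalIntegral.integral_div]
    exact div_self (pti_len_pos hf h0).ne'
  hc := fun i => ContinuousOn.const_smul (g := nablaSIter f i (kappa f))
    ((pti_smooth_iter hf i).continuousOn.mono h0) (curveLen f ^ (i+1))
  hd := by
    intro i j x hx
    have hL := (pti_len_pos hf h0).ne'
    have h := (pti_inner_deriv hf i j (h0 x hx)).const_mul (curveLen f ^ (i+1) * curveLen f ^ (j+1))
    simp only [real_inner_smul_left, real_inner_smul_right]
    have hfun : (fun x => curveLen f ^ (j + 1) * (curveLen f ^ (i + 1) *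
        ⟪nablaSIter f i (kappa f) x, nablaSIter f j (kappa f) x⟫)) =
        fun y => curveLen f ^ (i + 1) * curveLen f ^ (j + 1) *
          ⟪nablaSIter f i (kappa f) y, nablaSIter f j (kappa f) y⟫ := by
      funext x; ring
    rw [hfun]
    refine h.congr_deriv ?_
    field_simp
    ring

lemma pti_knorm (hf : ContDiff ℝ (⊤ : ℕ∞) f) (h0 : ∀ x ∈ Icc (0 : ℝ) 1, deriv f x ≠ 0) (i : ℕ) :
    knorm f i 2 = ptiN (fun i x => curveLen f ^ (i+1) • nablaSIter f i (kappa f) x)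
      (fun x => ‖deriv f x‖ / curveLen f) i := by
  have hL := pti_len_pos hf h0
  unfold knorm ptiN
  have e : (fun x => ‖curveLen f ^ (i+1) • nablaSIter f i (kappa f) x‖ ^ 2 *
      (‖deriv f x‖ / curveLen f)) = fun x => curveLen f ^ (2*i+1) *
        (‖nablaSIter f i (kappa f) x‖ ^ (2:ℝ) * ‖deriv f x‖) := by
    funext x
    rw [norm_smul, Real.norm_of_nonneg (by positivity), Real.rpow_two]
    field_simp
    ring
  simp only [e]
  rw [intervalIntegral.integral_const_mul, Real.sqrt_mul (by positivity), ← Real.sqrt_eq_rpow]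
  congr 1
  rw [Real.sqrt_eq_rpow, ← Real.rpow_natCast, ← Real.rpow_mul hL.le]
  congr 1; push_cast; ring

end geom

/-- Interpolation estimate for the `P`-terms:
`∫₀¹ ∏ⱼ |∇ₛ^{iⱼ}κ| ds ≤ C L^{1−a−b} ‖κ‖₂^{b−γ} ‖κ‖_{ℓ+2,2}^γ`,
with `γ = (a + b/2 − 1)/(ℓ+2)` and `C = C(n, ℓ, a, b)`. -/
theorem P_term_interpolation (n : ℕ) (hn : 2 ≤ n) (a b ℓ : ℕ)
    (hb : 2 ≤ b) (ha : a < 2 * (ℓ + 2)) :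
    ∃ C : ℝ, 0 < C ∧
      ∀ c : ℕ, c ≤ ℓ + 2 →
      ∀ f : ℝ → EuclideanSpace ℝ (Fin n),
        ContDiff ℝ (⊤ : ℕ∞) f → (∀ x ∈ Icc (0 : ℝ) 1, deriv f x ≠ 0) →
      ∀ i : Fin b → ℕ, (∑ j, i j) = a → (∀ j, i j ≤ c) →
        (∫ x in (0 : ℝ)..1, (∏ j, ‖nablaSIter f (i j) (kappa f) x‖) * ‖deriv f x‖)
          ≤ C * curveLen f ^ (1 - (a : ℝ) - (b : ℝ))
              * knorm f 0 2 ^ ((b : ℝ) - ((a : ℝ) + (b : ℝ) / 2 - 1) / ((ℓ : ℝ) + 2))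
              * knormSum f (ℓ + 2) 2 ^ (((a : ℝ) + (b : ℝ) / 2 - 1) / ((ℓ : ℝ) + 2)) := by
  refine ⟨(2 * 1000 ^ ((ℓ+2)^2)) ^ b, by positivity, ?_⟩
  intro c hc f hf h0 i hi hic
  have hL := pti_len_pos hf h0
  have M := (pti_chain hf h0).main (ℓ+2) a b (by omega) hb ha i hi (fun j => (hic j).trans hc)
  have hT : ∀ k, ptiT (fun i x => curveLen f ^ (i+1) • nablaSIter f i (kappa f) x)
      (fun x => ‖deriv f x‖ / curveLen f) k = knormSum f k 2 := by
    intro k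
    unfold ptiT knormSum
    exact Finset.sum_congr rfl (fun i _ => (pti_knorm hf h0 i).symm)
  have hT0 : knormSum f 0 2 = knorm f 0 2 := by simp [knormSum]
  rw [hT, hT, hT0] at M
  have e : (fun x => (∏ j, ‖curveLen f ^ (i j+1) • nablaSIter f (i j) (kappa f) x‖) *
      (‖deriv f x‖ / curveLen f)) = fun x => curveLen f ^ ((a:ℝ) + b - 1) *
        ((∏ j, ‖nablaSIter f (i j) (kappa f) x‖) * ‖deriv f x‖) := by
    funext x
    have hp : ∏ j, curveLen f ^ (i j + 1) = curveLen f ^ (a + b) := by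
      rw [Finset.prod_pow_eq_pow_sum, Finset.sum_add_distrib, hi]; simp
    have hq : curveLen f ^ ((a:ℝ) + b - 1) = curveLen f ^ (a+b) / curveLen f := by
      rw [Real.rpow_sub hL, Real.rpow_one, ← Real.rpow_natCast]; push_cast; rfl
    simp only [norm_smul, Finset.prod_mul_distrib]
    have hn' : ∀ j, ‖curveLen f ^ (i j + 1)‖ = curveLen f ^ (i j + 1) :=
      fun j => Real.norm_of_nonneg (by positivity)
    simp only [hn']
    rw [hp, hq]; ring
  simp only [e] at M
  rw [intervalIntegral.integral_const_mul] at M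
  push_cast at M
  have hpos : 0 < curveLen f ^ ((a:ℝ) + b - 1) := Real.rpow_pos_of_pos hL _
  have hinv : curveLen f ^ (1 - (a:ℝ) - b) = (curveLen f ^ ((a:ℝ) + b - 1))⁻¹ := by
    rw [← Real.rpow_neg hL.le]; congr 1; ring
  rw [hinv]
  rw [← le_div_iff₀' hpos] at M
  refine M.trans (le_of_eq ?_)
  rw [div_eq_mul_inv]; ring
end
end
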